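/- arXiv:1605.07774 — 11 statements merged into one kernel-verified Lean document; each statement's English description precedes it below -/
import Mathlib

section
/- Convergence of generalized mirror descent with per-block step sizes on a smooth convex function: let 𝒦 = 𝒦₁ × ⋯ × 𝒦_n with each 𝒦_i ⊆ ℝ^{d_i} a compact convex set, let Φ : 𝒦 → ℝ be a differentiable convex function that is λ-smooth with respect to (R₁,…,R_n), and let q = (q₁,…,q_n) be a minimizer of Φ over 𝒦. Suppose the sequence (x^t)_{t≥0} starts from x⁰ = (x⁰₁,…,x⁰_n) ∈ 𝒦 with B^{R_i}(q_i, x⁰_i) ≤ γ for every i, and satisfies the update x_i^{t+1} = argmin_{z∈𝒦_i} { η_i ⟨∇_iΦ(x^t), z⟩ + B^{R_i}(z, x_i^t) } for every i and t, where each step size satisfies η ≤ η_i ≤ 1/λ for some η > 0. Then for every ε ∈ (0,1) and every integer T ≥ nγ/(ηε), one has Φ(x^T) ≤ Φ(q) + ε (indeed Φ(x^T) − Φ(q) ≤ nγ/(ηT) for every T ≥ 1). -/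
open Finset RealInnerProductSpace

/-- The Bregman divergence `B^R(u,v) = R(u) − R(v) − ⟨∇R(v), u−v⟩` generated by a
regularizer `R` with gradient map `gR`. -/
noncomputable def breg {k : ℕ} (R : EuclideanSpace ℝ (Fin k) → ℝ)
    (gR : EuclideanSpace ℝ (Fin k) → EuclideanSpace ℝ (Fin k))
    (u v : EuclideanSpace ℝ (Fin k)) : ℝ :=
  R u - R v - ⟪gR v, u - v⟫

theorem breg_nonneg_aux {k : ℕ} {K : Set (EuclideanSpace ℝ (Fin k))}
    {R : EuclideanSpace ℝ (Fin k) → ℝ}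
    {gR : EuclideanSpace ℝ (Fin k) → EuclideanSpace ℝ (Fin k)}
    (hR : ConvexOn ℝ K R) {u v : EuclideanSpace ℝ (Fin k)} (hu : u ∈ K) (hv : v ∈ K)
    (hg : HasGradientAt R (gR v) v) : 0 ≤ breg R gR u v := by
  have h1 : ConvexOn ℝ (AffineMap.lineMap v u ⁻¹' K) (R ∘ (AffineMap.lineMap v u : ℝ →ᵃ[ℝ] _)) :=
    hR.comp_affineMap _
  have h2 : HasDerivAt (R ∘ (AffineMap.lineMap v u : ℝ →ᵃ[ℝ] _)) ⟪gR v, u - v⟫ (0:ℝ) := by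
    have hl : HasDerivAt (AffineMap.lineMap v u : ℝ → EuclideanSpace ℝ (Fin k)) (u - v) (0:ℝ) :=
      AffineMap.hasDerivAt_lineMap
    have hg' : HasFDerivAt R (InnerProductSpace.toDual ℝ _ (gR v))
        ((AffineMap.lineMap v u : ℝ → EuclideanSpace ℝ (Fin k)) 0) := by
      simpa using hg.hasFDerivAt
    simpa using hg'.comp_hasDerivAt (0:ℝ) hl
  have h3 := h1.le_slope_of_hasDerivAt (x := 0) (y := 1) (by simpa using hv) (by simpa using hu)
    one_pos h2
  simp [slope_def_field] at h3
  unfold breg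
  simp only [inner_sub_right] at *
  linarith

theorem breg_eq_aux {k : ℕ} {K : Set (EuclideanSpace ℝ (Fin k))}
    {R : EuclideanSpace ℝ (Fin k) → ℝ}
    {gR : EuclideanSpace ℝ (Fin k) → EuclideanSpace ℝ (Fin k)}
    (hR : StrictConvexOn ℝ K R) {u v : EuclideanSpace ℝ (Fin k)} (hu : u ∈ K) (hv : v ∈ K)
    (hg : HasGradientAt R (gR v) v) (h : breg R gR u v ≤ 0) : u = v := by
  by_contra hne
  have hm : (1/2:ℝ) • u + (1/2:ℝ) • v ∈ K :=
    hR.1 hu hv (by norm_num) (by norm_num) (by norm_num)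
  have h1 := hR.2 hu hv hne (show (0:ℝ) < 1/2 by norm_num) (show (0:ℝ) < 1/2 by norm_num) (by norm_num)
  have h2 := breg_nonneg_aux hR.convexOn hm hv hg
  unfold breg at h h2
  simp only [inner_sub_right, inner_add_right, inner_smul_right, smul_eq_mul] at h h1 h2
  linarith

theorem three_point_aux {k : ℕ} {K : Set (EuclideanSpace ℝ (Fin k))} (hK : Convex ℝ K)
    {R : EuclideanSpace ℝ (Fin k) → ℝ}
    {gR : EuclideanSpace ℝ (Fin k) → EuclideanSpace ℝ (Fin k)}
    {g p v q : EuclideanSpace ℝ (Fin k)} {e : ℝ} (hp : p ∈ K) (hq : q ∈ K)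
    (hg : HasGradientAt R (gR p) p)
    (hmin : ∀ z ∈ K, e * ⟪g, p⟫ + breg R gR p v ≤ e * ⟪g, z⟫ + breg R gR z v) :
    e * ⟪g, p - q⟫ ≤ breg R gR q v - breg R gR q p - breg R gR p v := by
  have hl : IsLocalMinOn (fun z => e * ⟪g, z⟫ + breg R gR z v) K p :=
    IsMinOn.localize (fun z hz => hmin z hz)
  have hd : HasFDerivAt (fun z => e * ⟪g, z⟫ + breg R gR z v)
      (e • innerSL ℝ g + (InnerProductSpace.toDual ℝ _ (gR p) - innerSL ℝ (gR v))) p := by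
    have a1 : HasFDerivAt (fun z => e * ⟪g, z⟫) (e • innerSL ℝ g) p :=
      ((innerSL ℝ g).hasFDerivAt (x := p)).const_mul e
    have a2 : HasFDerivAt (fun z => ⟪gR v, z - v⟫) (innerSL ℝ (gR v)) p := by
      have := ((innerSL ℝ (gR v)).hasFDerivAt (x := p)).sub_const ⟪gR v, v⟫
      simpa [inner_sub_right] using this
    exact a1.add ((hg.hasFDerivAt.sub_const _).sub a2)
  have h := hl.hasFDerivWithinAt_nonneg hd.hasFDerivWithinAt
    (sub_mem_posTangentConeAt_of_segment_subset (hK.segment_subset hp hq))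
  simp [inner_sub_right] at h
  unfold breg
  simp only [inner_sub_right]
  linarith

/-- convergence of generalized mirror descent with per-block step sizes on a
smooth convex function.  `Φ` is a differentiable convex function on
`𝒦 = 𝒦₁ × ⋯ × 𝒦_n` (convexity given via the gradient inequality for its gradient `gΦ`),
`λ`-smooth with respect to `(R₁,…,R_n)`, `q` a minimizer, and each block is updated by
the Bregman proximal rule with step size `η_i ∈ [η, 1/λ]`.  Then for `ε ∈ (0,1)` and any
`T ≥ nγ/(ηε)` we have `Φ(x^T) ≤ Φ(q) + ε`; indeed `Φ(x^T) − Φ(q) ≤ nγ/(ηT)` for all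
`T ≥ 1`. -/
theorem mirror_descent_converges
    {n : ℕ} (hn : 0 < n) (d : Fin n → ℕ)
    (K : (i : Fin n) → Set (EuclideanSpace ℝ (Fin (d i))))
    (hKconv : ∀ i, Convex ℝ (K i)) (hKcpt : ∀ i, IsCompact (K i))
    (hKne : ∀ i, (K i).Nonempty)
    (Φ : ((i : Fin n) → EuclideanSpace ℝ (Fin (d i))) → ℝ)
    (gΦ : ((i : Fin n) → EuclideanSpace ℝ (Fin (d i))) →
          ((i : Fin n) → EuclideanSpace ℝ (Fin (d i))))
    (hconv : ∀ x y, (∀ i, x i ∈ K i) → (∀ i, y i ∈ K i) →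
      Φ x + ∑ i, ⟪gΦ x i, y i - x i⟫ ≤ Φ y)
    (R : (i : Fin n) → EuclideanSpace ℝ (Fin (d i)) → ℝ)
    (gR : (i : Fin n) → EuclideanSpace ℝ (Fin (d i)) → EuclideanSpace ℝ (Fin (d i)))
    (hRgradAt : ∀ i, ∀ v ∈ K i, HasGradientAt (R i) (gR i v) v)
    (hRstrict : ∀ i, StrictConvexOn ℝ (K i) (R i))
    (lam γ η : ℝ) (hlam : 0 < lam) (hη : 0 < η) (hγ : 0 ≤ γ)
    (hsmooth : ∀ x y, (∀ i, x i ∈ K i) → (∀ i, y i ∈ K i) →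
      Φ y ≤ Φ x + ∑ i, ⟪gΦ x i, y i - x i⟫
            + lam * ∑ i, breg (R i) (gR i) (y i) (x i))
    (q : (i : Fin n) → EuclideanSpace ℝ (Fin (d i)))
    (hqK : ∀ i, q i ∈ K i) (hqmin : ∀ z, (∀ i, z i ∈ K i) → Φ q ≤ Φ z)
    (x : ℕ → (i : Fin n) → EuclideanSpace ℝ (Fin (d i)))
    (hx0K : ∀ i, x 0 i ∈ K i)
    (hx0γ : ∀ i, breg (R i) (gR i) (q i) (x 0 i) ≤ γ)
    (eta : Fin n → ℝ) (heta1 : ∀ i, η ≤ eta i) (heta2 : ∀ i, eta i ≤ 1 / lam)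
    (hupdate : ∀ t i, x (t + 1) i ∈ K i ∧ ∀ z ∈ K i,
      eta i * ⟪gΦ (x t) i, x (t + 1) i⟫ + breg (R i) (gR i) (x (t + 1) i) (x t i)
        ≤ eta i * ⟪gΦ (x t) i, z⟫ + breg (R i) (gR i) z (x t i)) :
    (∀ ε ∈ Set.Ioo (0:ℝ) 1, ∀ T : ℕ, (n : ℝ) * γ / (η * ε) ≤ T →
      Φ (x T) ≤ Φ q + ε) ∧
    (∀ T : ℕ, 1 ≤ T → Φ (x T) - Φ q ≤ (n : ℝ) * γ / (η * T)) := by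
  have hxK : ∀ t i, x t i ∈ K i := by
    intro t i
    cases t with
    | zero => exact hx0K i
    | succ t => exact (hupdate t i).1
  have hepos : ∀ i, 0 < eta i := fun i => hη.trans_le (heta1 i)
  have hB : ∀ i u v, u ∈ K i → v ∈ K i → 0 ≤ breg (R i) (gR i) u v := fun i u v hu hv =>
    breg_nonneg_aux (hRstrict i).convexOn hu hv (hRgradAt i v hv)
  have hlame : ∀ i, lam ≤ (eta i)⁻¹ := fun i => by
    rw [le_inv_comm₀ hlam (hepos i)]; simpa using heta2 i
  -- descent
  have hmono : ∀ t, Φ (x (t + 1)) ≤ Φ (x t) := by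
    intro t
    have h1 := hsmooth (x t) (x (t+1)) (hxK t) (hxK (t+1))
    have h2 : ∑ i, (⟪gΦ (x t) i, x (t+1) i - x t i⟫
        + lam * breg (R i) (gR i) (x (t+1) i) (x t i)) ≤ 0 := by
      refine Finset.sum_nonpos fun i _ => ?_
      have h3 := (hupdate t i).2 (x t i) (hxK t i)
      have h4 : breg (R i) (gR i) (x t i) (x t i) = 0 := by simp [breg]
      have h5 := hB i _ _ (hxK (t+1) i) (hxK t i)
      have h6 := mul_le_mul_of_nonneg_right (hlame i) h5
      have h7 : eta i * (⟪gΦ (x t) i, x (t+1) i - x t i⟫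
        + (eta i)⁻¹ * breg (R i) (gR i) (x (t+1) i) (x t i)) ≤ 0 := by
        rw [mul_add, mul_inv_cancel_left₀ (hepos i).ne', inner_sub_right]
        linarith
      have h8 := nonpos_of_mul_nonpos_right h7 (hepos i)
      linarith
    rw [Finset.sum_add_distrib, ← Finset.mul_sum] at h2
    linarith
  have hstep : ∀ t, Φ (x (t + 1)) - Φ q + ∑ i, (eta i)⁻¹ * breg (R i) (gR i) (q i) (x (t+1) i)
      ≤ ∑ i, (eta i)⁻¹ * breg (R i) (gR i) (q i) (x t i) := by
    intro t
    have h1 := hsmooth (x t) (x (t+1)) (hxK t) (hxK (t+1))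
    have h0 := hconv (x t) q (hxK t) hqK
    have h2 : ∑ i, (⟪gΦ (x t) i, x (t+1) i - x t i⟫
        + lam * breg (R i) (gR i) (x (t+1) i) (x t i)
        + (eta i)⁻¹ * breg (R i) (gR i) (q i) (x (t+1) i)) ≤
        ∑ i, (⟪gΦ (x t) i, q i - x t i⟫
        + (eta i)⁻¹ * breg (R i) (gR i) (q i) (x t i)) := by
      refine Finset.sum_le_sum fun i _ => ?_
      have h3 := three_point_aux (hKconv i) (hupdate t i).1 (hqK i)
        (hRgradAt i _ (hupdate t i).1) (hupdate t i).2
      have h5 := hB i _ _ (hxK (t+1) i) (hxK t i)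
      have h6 := mul_le_mul_of_nonneg_right (hlame i) h5
      have h7 := mul_le_mul_of_nonneg_left h3 (inv_pos.2 (hepos i)).le
      rw [inv_mul_cancel_left₀ (hepos i).ne'] at h7
      simp only [inner_sub_right] at h7 ⊢
      linarith
    rw [Finset.sum_add_distrib, Finset.sum_add_distrib, Finset.sum_add_distrib,
      ← Finset.mul_sum] at h2
    linarith
  have htel : ∀ T : ℕ, (T : ℝ) * (Φ (x T) - Φ q)
      + ∑ i, (eta i)⁻¹ * breg (R i) (gR i) (q i) (x T i)
      ≤ ∑ i, (eta i)⁻¹ * breg (R i) (gR i) (q i) (x 0 i) := by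
    intro T
    induction T with
    | zero => simp
    | succ T ih =>
      have h1 := hstep T
      have h2 := mul_le_mul_of_nonneg_left (hmono T) (Nat.cast_nonneg (α := ℝ) T)
      push_cast
      linarith
  have hsum0 : ∑ i, (eta i)⁻¹ * breg (R i) (gR i) (q i) (x 0 i) ≤ n * γ / η := by
    have : ∀ i ∈ (Finset.univ : Finset (Fin n)),
        (eta i)⁻¹ * breg (R i) (gR i) (q i) (x 0 i) ≤ η⁻¹ * γ := fun i _ =>
      mul_le_mul (inv_anti₀ hη (heta1 i)) (hx0γ i) (hB i _ _ (hqK i) (hx0K i)) (inv_pos.2 hη).le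
    refine (Finset.sum_le_sum this).trans (le_of_eq ?_)
    simp
    ring
  have hrate : ∀ T : ℕ, 1 ≤ T → Φ (x T) - Φ q ≤ (n : ℝ) * γ / (η * T) := by
    intro T hT
    have hT' : (0:ℝ) < T := by exact_mod_cast hT
    have h1 : 0 ≤ ∑ i, (eta i)⁻¹ * breg (R i) (gR i) (q i) (x T i) :=
      Finset.sum_nonneg fun i _ =>
        mul_nonneg (inv_pos.2 (hepos i)).le (hB i _ _ (hqK i) (hxK T i))
    have h2 := htel T
    rw [← div_div, le_div_iff₀ hT']
    linarith
  refine ⟨?_, hrate⟩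
  rintro ε ⟨hε, -⟩ T hT
  rcases Nat.eq_zero_or_pos T with rfl | hTpos
  · have hn' : (0:ℝ) < n := by exact_mod_cast hn
    rw [Nat.cast_zero, div_le_iff₀ (mul_pos hη hε), zero_mul] at hT
    have hγ0 : γ ≤ 0 := nonpos_of_mul_nonpos_right hT hn'
    have : q = x 0 := funext fun i =>
      breg_eq_aux (hRstrict i) (hqK i) (hx0K i) (hRgradAt i _ (hx0K i)) ((hx0γ i).trans hγ0)
    rw [← this]
    linarith
  · have hT' : (0:ℝ) < T := by exact_mod_cast hTpos
    have h1 := hrate T hTpos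
    have h2 : (n : ℝ) * γ / (η * T) ≤ ε := by
      rw [div_le_iff₀ (mul_pos hη hε)] at hT
      rw [div_le_iff₀ (mul_pos hη hT')]
      linarith
    linarith
end

section
/- Monotone decrease of generalized mirror descent: let 𝒦 = 𝒦₁ × ⋯ × 𝒦_n with each 𝒦_i ⊆ ℝ^{d_i} a compact convex set, let Φ : 𝒦 → ℝ be a differentiable convex function that is λ-smooth with respect to (R₁,…,R_n), and suppose the sequence (x^t)_{t≥0} satisfies x_i^{t+1} = argmin_{z∈𝒦_i} { η_i ⟨∇_iΦ(x^t), z⟩ + B^{R_i}(z, x_i^t) } for every i and t, with 0 < η_i ≤ 1/λ for each i. Then Φ(x^{t+1}) ≤ Φ(x^t) for every integer t ≥ 0. -/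
open Finset RealInnerProductSpace

/-- monotone decrease of generalized mirror descent on a convex function
`Φ` that is `λ`-smooth with respect to `(R₁,…,R_n)`, with per-block step sizes
`0 < η_i ≤ 1/λ`: the potential never increases, `Φ(x^{t+1}) ≤ Φ(x^t)`. -/
theorem mirror_descent_monotone
    {n : ℕ} (hn : 0 < n) (d : Fin n → ℕ)
    (K : (i : Fin n) → Set (EuclideanSpace ℝ (Fin (d i))))
    (hKconv : ∀ i, Convex ℝ (K i)) (hKcpt : ∀ i, IsCompact (K i))
    (hKne : ∀ i, (K i).Nonempty)
    (Φ : ((i : Fin n) → EuclideanSpace ℝ (Fin (d i))) → ℝ)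
    (gΦ : ((i : Fin n) → EuclideanSpace ℝ (Fin (d i))) →
          ((i : Fin n) → EuclideanSpace ℝ (Fin (d i))))
    (hconv : ∀ x y, (∀ i, x i ∈ K i) → (∀ i, y i ∈ K i) →
      Φ x + ∑ i, ⟪gΦ x i, y i - x i⟫ ≤ Φ y)
    (R : (i : Fin n) → EuclideanSpace ℝ (Fin (d i)) → ℝ)
    (gR : (i : Fin n) → EuclideanSpace ℝ (Fin (d i)) → EuclideanSpace ℝ (Fin (d i)))
    (hRgradAt : ∀ i, ∀ v ∈ K i, HasGradientAt (R i) (gR i v) v)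
    (hRstrict : ∀ i, StrictConvexOn ℝ (K i) (R i))
    (lam : ℝ) (hlam : 0 < lam)
    (hsmooth : ∀ x y, (∀ i, x i ∈ K i) → (∀ i, y i ∈ K i) →
      Φ y ≤ Φ x + ∑ i, ⟪gΦ x i, y i - x i⟫
            + lam * ∑ i, breg (R i) (gR i) (y i) (x i))
    (x : ℕ → (i : Fin n) → EuclideanSpace ℝ (Fin (d i)))
    (hx0K : ∀ i, x 0 i ∈ K i)
    (eta : Fin n → ℝ) (heta1 : ∀ i, 0 < eta i) (heta2 : ∀ i, eta i ≤ 1 / lam)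
    (hupdate : ∀ t i, x (t + 1) i ∈ K i ∧ ∀ z ∈ K i,
      eta i * ⟪gΦ (x t) i, x (t + 1) i⟫ + breg (R i) (gR i) (x (t + 1) i) (x t i)
        ≤ eta i * ⟪gΦ (x t) i, z⟫ + breg (R i) (gR i) z (x t i)) :
    ∀ t : ℕ, Φ (x (t + 1)) ≤ Φ (x t) := by
  intro t
  have hK : ∀ t i, x t i ∈ K i := by
    intro t i
    cases t with
    | zero => exact hx0K i
    | succ k => exact (hupdate k i).1
  have hB0 : ∀ i, ∀ v, breg (R i) (gR i) v v = 0 := by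
    intro i v
    simp [breg]
  have hB : ∀ i, 0 ≤ breg (R i) (gR i) (x (t + 1) i) (x t i) := by
    intro i
    have hy : ∀ j, Function.update (x t) i (x (t + 1) i) j ∈ K j := by
      intro j
      by_cases h : j = i
      · subst h
        simpa using hK (t + 1) j
      · simpa [h] using hK t j
    have h1 := hconv _ _ (hK t) hy
    have h2 := hsmooth _ _ (hK t) hy
    have h3 : ∑ j, breg (R j) (gR j) (Function.update (x t) i (x (t + 1) i) j) (x t j)
        = breg (R i) (gR i) (x (t + 1) i) (x t i) := by
      rw [Finset.sum_eq_single i]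
      · simp
      · intro j _ h
        simp [h, hB0]
      · simp
    rw [h3] at h2
    have h4 : 0 ≤ lam * breg (R i) (gR i) (x (t + 1) i) (x t i) := by linarith
    exact nonneg_of_mul_nonneg_right h4 hlam
  have h := hsmooth _ _ (hK t) (hK (t + 1))
  have hs : ∑ i, (⟪gΦ (x t) i, x (t + 1) i - x t i⟫
      + lam * breg (R i) (gR i) (x (t + 1) i) (x t i)) ≤ 0 := by
    apply Finset.sum_nonpos
    intro i _
    have h1 := (hupdate t i).2 _ (hK t i)
    rw [hB0] at h1
    have h2 : eta i * lam ≤ 1 := (le_div_iff₀ hlam).1 (heta2 i)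
    have h3 := mul_le_mul_of_nonneg_right h2 (hB i)
    rw [inner_sub_right]
    refine nonpos_of_mul_nonpos_right (a := eta i) ?_ (heta1 i)
    linarith
  rw [Finset.sum_add_distrib, ← Finset.mul_sum] at hs
  linarith
end

section
/- Cumulative optimality-gap bound for generalized mirror descent: let 𝒦 = 𝒦₁ × ⋯ × 𝒦_n with each 𝒦_i ⊆ ℝ^{d_i} a compact convex set, let Φ : 𝒦 → ℝ be a differentiable convex function that is λ-smooth with respect to (R₁,…,R_n), let q = (q₁,…,q_n) be a minimizer of Φ over 𝒦, and suppose the sequence (x^t)_{t≥0} satisfies x_i^{t+1} = argmin_{z∈𝒦_i} { η_i ⟨∇_iΦ(x^t), z⟩ + B^{R_i}(z, x_i^t) } for every i and t, with 0 < η_i ≤ 1/λ for each i. Then for every integer T ≥ 1, Σ_{t=0}^{T−1} (Φ(x^{t+1}) − Φ(q)) ≤ Σ_{i=1}^n (1/η_i) · B^{R_i}(q_i, x⁰_i). -/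
open Finset RealInnerProductSpace

theorem md_first_order {k : ℕ} (K : Set (EuclideanSpace ℝ (Fin k))) (hK : Convex ℝ K)
    (R : EuclideanSpace ℝ (Fin k) → ℝ)
    (gR : EuclideanSpace ℝ (Fin k) → EuclideanSpace ℝ (Fin k))
    (hR : ∀ v ∈ K, HasGradientAt R (gR v) v) (e : ℝ) (g v p z : EuclideanSpace ℝ (Fin k))
    (hp : p ∈ K) (hz : z ∈ K)
    (hmin : ∀ z ∈ K, e * ⟪g, p⟫ + breg R gR p v ≤ e * ⟪g, z⟫ + breg R gR z v) :
    e * ⟪g, p - z⟫ ≤ breg R gR z v - breg R gR z p - breg R gR p v := by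
  have h1 : HasFDerivAt R (innerSL ℝ (gR p)) p := (hR p hp).hasFDerivAt
  have h2 : HasFDerivAt (fun z => e * innerSL ℝ g z + (R z - R v - innerSL ℝ (gR v) (z - v)))
      (e • innerSL ℝ g + (innerSL ℝ (gR p) - innerSL ℝ (gR v))) p := by
    have ha := ((innerSL ℝ g).hasFDerivAt (x := p)).const_mul e
    have hb := ((innerSL ℝ (gR v)).hasFDerivAt (x := p - v)).comp p
      ((hasFDerivAt_id p).sub_const v)
    exact ha.add ((h1.sub_const (R v)).sub hb)
  have hm : IsLocalMinOn (fun z => e * innerSL ℝ g z + (R z - R v - innerSL ℝ (gR v) (z - v)))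
      K p := by
    apply IsMinOn.localize
    intro z hz
    simpa [breg] using hmin z hz
  have h3 := hm.hasFDerivWithinAt_nonneg h2.hasFDerivWithinAt
    (sub_mem_posTangentConeAt_of_segment_subset (hK.segment_subset hp hz))
  simp only [breg, inner_sub_right, ContinuousLinearMap.add_apply, ContinuousLinearMap.sub_apply,
    ContinuousLinearMap.smul_apply, innerSL_apply_apply, smul_eq_mul] at h3 ⊢
  linarith

/-- cumulative optimality-gap bound for generalized mirror descent on a
convex `λ`-smooth function with per-block step sizes `0 < η_i ≤ 1/λ`:
`Σ_{t=0}^{T−1} (Φ(x^{t+1}) − Φ(q)) ≤ Σ_{i=1}^n (1/η_i)·B^{R_i}(q_i, x⁰_i)`. -/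
theorem mirror_descent_cumulative_gap
    {n : ℕ} (hn : 0 < n) (d : Fin n → ℕ)
    (K : (i : Fin n) → Set (EuclideanSpace ℝ (Fin (d i))))
    (hKconv : ∀ i, Convex ℝ (K i)) (hKcpt : ∀ i, IsCompact (K i))
    (hKne : ∀ i, (K i).Nonempty)
    (Φ : ((i : Fin n) → EuclideanSpace ℝ (Fin (d i))) → ℝ)
    (gΦ : ((i : Fin n) → EuclideanSpace ℝ (Fin (d i))) →
          ((i : Fin n) → EuclideanSpace ℝ (Fin (d i))))
    (hconv : ∀ x y, (∀ i, x i ∈ K i) → (∀ i, y i ∈ K i) →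
      Φ x + ∑ i, ⟪gΦ x i, y i - x i⟫ ≤ Φ y)
    (R : (i : Fin n) → EuclideanSpace ℝ (Fin (d i)) → ℝ)
    (gR : (i : Fin n) → EuclideanSpace ℝ (Fin (d i)) → EuclideanSpace ℝ (Fin (d i)))
    (hRgradAt : ∀ i, ∀ v ∈ K i, HasGradientAt (R i) (gR i v) v)
    (hRstrict : ∀ i, StrictConvexOn ℝ (K i) (R i))
    (lam : ℝ) (hlam : 0 < lam)
    (hsmooth : ∀ x y, (∀ i, x i ∈ K i) → (∀ i, y i ∈ K i) →
      Φ y ≤ Φ x + ∑ i, ⟪gΦ x i, y i - x i⟫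
            + lam * ∑ i, breg (R i) (gR i) (y i) (x i))
    (q : (i : Fin n) → EuclideanSpace ℝ (Fin (d i)))
    (hqK : ∀ i, q i ∈ K i) (hqmin : ∀ z, (∀ i, z i ∈ K i) → Φ q ≤ Φ z)
    (x : ℕ → (i : Fin n) → EuclideanSpace ℝ (Fin (d i)))
    (hx0K : ∀ i, x 0 i ∈ K i)
    (eta : Fin n → ℝ) (heta1 : ∀ i, 0 < eta i) (heta2 : ∀ i, eta i ≤ 1 / lam)
    (hupdate : ∀ t i, x (t + 1) i ∈ K i ∧ ∀ z ∈ K i,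
      eta i * ⟪gΦ (x t) i, x (t + 1) i⟫ + breg (R i) (gR i) (x (t + 1) i) (x t i)
        ≤ eta i * ⟪gΦ (x t) i, z⟫ + breg (R i) (gR i) z (x t i)) :
    ∀ T : ℕ, 1 ≤ T →
      ∑ t ∈ Finset.range T, (Φ (x (t + 1)) - Φ q)
        ≤ ∑ i, (1 / eta i) * breg (R i) (gR i) (q i) (x 0 i) := by
  have hxK : ∀ t i, x t i ∈ K i := by
    intro t
    cases t with
    | zero => exact hx0K
    | succ t => exact fun i => (hupdate t i).1
  have hB : ∀ i, ∀ u ∈ K i, ∀ v ∈ K i, 0 ≤ breg (R i) (gR i) u v := by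
    intro i u hu v hv
    have hw : ∀ j, Function.update q i v j ∈ K j := by
      intro j
      by_cases h : j = i
      · subst h; simpa using hv
      · simpa [Function.update_of_ne h] using hqK j
    have hy : ∀ j, Function.update q i u j ∈ K j := by
      intro j
      by_cases h : j = i
      · subst h; simpa using hu
      · simpa [Function.update_of_ne h] using hqK j
    have h1 := hconv _ _ hw hy
    have h2 := hsmooth _ _ hw hy
    have h3 : ∑ j, breg (R j) (gR j) (Function.update q i u j) (Function.update q i v j)
        = breg (R i) (gR i) u v := by
      rw [Finset.sum_eq_single i]
      · simp
      · intro j _ h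
        simp [Function.update_of_ne h, breg]
      · simp
    rw [h3] at h2
    have h4 : 0 ≤ lam * breg (R i) (gR i) u v := by linarith
    exact nonneg_of_mul_nonneg_right h4 hlam
  have hstep : ∀ t, Φ (x (t + 1)) - Φ q ≤
      ∑ i, (1 / eta i) * breg (R i) (gR i) (q i) (x t i)
      - ∑ i, (1 / eta i) * breg (R i) (gR i) (q i) (x (t + 1) i) := by
    intro t
    have h1 := hconv _ _ (hxK t) hqK
    have h2 := hsmooth _ _ (hxK t) (hxK (t + 1))
    have h3 : ∑ i, ⟪gΦ (x t) i, x (t + 1) i - x t i⟫ - ∑ i, ⟪gΦ (x t) i, q i - x t i⟫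
        + lam * ∑ i, breg (R i) (gR i) (x (t + 1) i) (x t i) ≤
      ∑ i, (1 / eta i) * breg (R i) (gR i) (q i) (x t i)
      - ∑ i, (1 / eta i) * breg (R i) (gR i) (q i) (x (t + 1) i) := by
      rw [Finset.mul_sum, ← Finset.sum_sub_distrib, ← Finset.sum_sub_distrib,
        ← Finset.sum_add_distrib]
      apply Finset.sum_le_sum
      intro i _
      have hf := md_first_order (K i) (hKconv i) (R i) (gR i) (hRgradAt i) (eta i) (gΦ (x t) i)
        (x t i) (x (t + 1) i) (q i) (hupdate t i).1 (hqK i) (hupdate t i).2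
      have hb := hB i _ (hxK (t + 1) i) _ (hxK t i)
      have he : lam ≤ 1 / eta i := by
        have := heta2 i
        rw [le_div_iff₀ hlam] at this
        rw [le_div_iff₀ (heta1 i)]
        linarith
      have hm := mul_le_mul_of_nonneg_right he hb
      have hf2 := mul_le_mul_of_nonneg_left hf (one_div_pos.mpr (heta1 i)).le
      rw [← mul_assoc, one_div_mul_cancel (heta1 i).ne', one_mul] at hf2
      simp only [inner_sub_right] at hf2 ⊢
      linarith
    linarith
  intro T _
  have h1 := Finset.sum_le_sum (s := Finset.range T) (fun t _ => hstep t)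
  rw [Finset.sum_range_sub' (fun t => ∑ i, (1 / eta i) * breg (R i) (gR i) (q i) (x t i))] at h1
  have h2 : 0 ≤ ∑ i, (1 / eta i) * breg (R i) (gR i) (q i) (x T i) :=
    Finset.sum_nonneg fun i _ =>
      mul_nonneg (one_div_pos.mpr (heta1 i)).le (hB i _ (hqK i) _ (hxK T i))
  linarith
end

section
/- Near-minimizers of the potential are approximate Wardrop equilibria: in a nonatomic congestion game whose edge cost functions are nondecreasing and continuously differentiable with c_e'(y) ≤ b on [0,1], let q be a minimizer of Φ over 𝒦 and let ε > 0. Let x ∈ 𝒦 satisfy Φ(x) ≤ Φ(q) + ε, and suppose in addition that every strictly positive coordinate of x satisfies x_{i,s} ≥ √(ε/(2bm)). Then x is a δ-equilibrium for some δ ≤ √(8bmε); that is, for every player i and all paths s, s' ∈ 𝒮_i with x_{i,s} > 0, c_s(x) ≤ c_{s'}(x) + √(8bmε). -/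
open Finset MeasureTheory

/-- The load on edge `e` induced by the strategy profile `x`. -/
noncomputable def load {n : ℕ} {E : Type*} [Fintype E] [DecidableEq E]
    (S : Fin n → Finset (Finset E)) (x : Fin n → Finset E → ℝ) (e : E) : ℝ :=
  ∑ i, ∑ s ∈ (S i).filter (fun s => e ∈ s), x i s

/-- The cost of a path `s`: `c_s(x) = Σ_{e∈s} c_e(ℓ_e(x))`. -/
noncomputable def pathCost {n : ℕ} {E : Type*} [Fintype E] [DecidableEq E]
    (S : Fin n → Finset (Finset E)) (c : E → ℝ → ℝ)
    (x : Fin n → Finset E → ℝ) (s : Finset E) : ℝ :=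
  ∑ e ∈ s, c e (load S x e)

/-- The potential function `Φ(x) = Σ_{e∈E} ∫_0^{ℓ_e(x)} c_e(y) dy`. -/
noncomputable def potential {n : ℕ} {E : Type*} [Fintype E] [DecidableEq E]
    (S : Fin n → Finset (Finset E)) (c : E → ℝ → ℝ)
    (x : Fin n → Finset E → ℝ) : ℝ :=
  ∑ e : E, ∫ y in (0:ℝ)..(load S x e), c e y

/-- `x` is a feasible strategy profile. -/
def IsProfile {n : ℕ} {E : Type*} [Fintype E] [DecidableEq E]
    (S : Fin n → Finset (Finset E)) (x : Fin n → Finset E → ℝ) : Prop :=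
  (∀ i s, 0 ≤ x i s) ∧ (∀ i, ∀ s ∉ S i, x i s = 0) ∧ (∀ i, ∑ s ∈ S i, x i s = 1 / (n:ℝ))

lemma edge_bound (c c' : ℝ → ℝ) (b : ℝ)
    (hderiv : ∀ y ∈ Set.Icc (0:ℝ) 1, HasDerivWithinAt c (c' y) (Set.Icc 0 1) y)
    (hbd : ∀ y ∈ Set.Icc (0:ℝ) 1, 0 ≤ c' y ∧ c' y ≤ b)
    (hb : 0 < b)
    (u v : ℝ) (hu : u ∈ Set.Icc (0:ℝ) 1) (hv : v ∈ Set.Icc (0:ℝ) 1) :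
    (∫ y in (0:ℝ)..v, c y) ≤ (∫ y in (0:ℝ)..u, c y) + c u * (v - u) + b * (v - u) ^ 2 := by
  have hcont : ContinuousOn c (Set.Icc 0 1) := fun y hy => (hderiv y hy).continuousWithinAt
  have hint : ∀ p ∈ Set.Icc (0:ℝ) 1, ∀ r ∈ Set.Icc (0:ℝ) 1,
      IntervalIntegrable c volume p r := fun p hp r hr =>
    (hcont.mono (Set.uIcc_subset_Icc hp hr)).intervalIntegrable
  have h0 : (0:ℝ) ∈ Set.Icc (0:ℝ) 1 := by simp
  have hlip : ∀ y ∈ Set.Icc (0:ℝ) 1, ‖c y - c u‖ ≤ b * ‖y - u‖ := fun y hy =>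
    (convex_Icc (0:ℝ) 1).norm_image_sub_le_of_norm_hasDerivWithin_le hderiv
      (fun z hz => by
        rw [Real.norm_eq_abs, abs_of_nonneg (hbd z hz).1]; exact (hbd z hz).2) hu hy
  have hsub : (∫ y in u..v, (c y - c u)) = (∫ y in u..v, c y) - (v - u) * c u := by
    rw [intervalIntegral.integral_sub (hint u hu v hv) (by simp)]
    simp
  have hn : ‖∫ y in u..v, (c y - c u)‖ ≤ (b * |v - u|) * |v - u| := by
    apply intervalIntegral.norm_integral_le_of_norm_le_const
    intro y hy
    have hy' := Set.uIoc_subset_uIcc hy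
    refine (hlip y (Set.uIcc_subset_Icc hu hv hy')).trans ?_
    rw [Real.norm_eq_abs]
    exact mul_le_mul_of_nonneg_left (Set.abs_sub_left_of_mem_uIcc hy') hb.le
  have hadd := intervalIntegral.integral_add_adjacent_intervals (hint 0 h0 u hu) (hint u hu v hv)
  rw [Real.norm_eq_abs, mul_assoc, abs_mul_abs_self] at hn
  have := (abs_le.mp hn).2
  nlinarith

lemma load_mem {n : ℕ} (hn : 0 < n) {E : Type*} [Fintype E] [DecidableEq E]
    (S : Fin n → Finset (Finset E)) (x : Fin n → Finset E → ℝ) (hx : IsProfile S x) (e : E) :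
    load S x e ∈ Set.Icc (0:ℝ) 1 := by
  obtain ⟨h0, -, h1⟩ := hx
  refine ⟨Finset.sum_nonneg fun i _ => Finset.sum_nonneg fun s _ => h0 i s, ?_⟩
  calc load S x e ≤ ∑ i : Fin n, 1 / (n:ℝ) := by
        refine Finset.sum_le_sum fun i _ => ?_
        rw [← h1 i]
        exact Finset.sum_le_sum_of_subset_of_nonneg (Finset.filter_subset _ _)
          (fun s _ _ => h0 i s)
    _ = 1 := by
        have : (n:ℝ) ≠ 0 := by positivity
        simp [this]

/-- move `t` from `s` to `s'` -/
noncomputable def shift {n : ℕ} {E : Type*} [DecidableEq E]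
    (x : Fin n → Finset E → ℝ) (i : Fin n) (s s' : Finset E) (t : ℝ) :
    Fin n → Finset E → ℝ :=
  fun j r => x j r + if j = i then (if r = s' then t else 0) - (if r = s then t else 0) else 0

lemma load_shift {n : ℕ} {E : Type*} [Fintype E] [DecidableEq E]
    (S : Fin n → Finset (Finset E)) (x : Fin n → Finset E → ℝ) (i : Fin n) (s s' : Finset E)
    (hs : s ∈ S i) (hs' : s' ∈ S i) (t : ℝ) (e : E) :
    load S (shift x i s s' t) e
      = load S x e + ((if e ∈ s' then t else 0) - (if e ∈ s then t else 0)) := by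
  unfold load shift
  simp only [Finset.sum_add_distrib]
  congr 1
  rw [Finset.sum_eq_single i (fun j _ hj => by simp [hj]) (by simp)]
  simp [Finset.sum_sub_distrib, Finset.sum_ite_eq', hs, hs']

lemma profile_shift {n : ℕ} {E : Type*} [Fintype E] [DecidableEq E]
    (S : Fin n → Finset (Finset E)) (x : Fin n → Finset E → ℝ) (hx : IsProfile S x)
    (i : Fin n) (s s' : Finset E)
    (hs : s ∈ S i) (hs' : s' ∈ S i) (t : ℝ) (ht : 0 ≤ t) (htx : t ≤ x i s) :
    IsProfile S (shift x i s s' t) := by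
  obtain ⟨h0, hz, h1⟩ := hx
  refine ⟨fun j r => ?_, fun j r hr => ?_, fun j => ?_⟩
  · have := h0 j r
    unfold shift
    by_cases hj : j = i
    · subst hj
      by_cases hr : r = s
      · subst hr
        simp only [if_true]
        split_ifs <;> linarith
      · simp only [hr, if_true, if_false]
        split_ifs <;> linarith
    · simpa [hj] using this
  · unfold shift
    rw [hz j r hr]
    by_cases hj : j = i
    · subst hj
      have a : r ≠ s := fun h => hr (h ▸ hs)
      have a' : r ≠ s' := fun h => hr (h ▸ hs')
      simp [a, a']
    · simp [hj]
  · unfold shift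
    rw [Finset.sum_add_distrib, h1 j]
    by_cases hj : j = i
    · subst hj
      simp [Finset.sum_sub_distrib, Finset.sum_ite_eq', hs, hs']
    · simp [hj]

/-- near-minimizers of the potential are approximate Wardrop equilibria.
If the edge costs are nondecreasing and continuously differentiable with `c_e' ≤ b` on
`[0,1]`, `q` minimizes `Φ`, `Φ(x) ≤ Φ(q) + ε`, and every strictly positive coordinate of
`x` is at least `√(ε/(2bm))`, then `x` is a `δ`-equilibrium for `δ = √(8bmε)`:
for every player `i` and all `s, s' ∈ 𝒮_i` with `x_{i,s} > 0`,
`c_s(x) ≤ c_{s'}(x) + √(8bmε)`. -/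
theorem near_minimizer_approx_equilibrium
    {n : ℕ} (hn : 0 < n) {E : Type*} [Fintype E] [DecidableEq E]
    (S : Fin n → Finset (Finset E))
    (hSne : ∀ i, (S i).Nonempty)
    (hpaths : ∀ i, ∀ s ∈ S i, s.Nonempty)
    (c c' : E → ℝ → ℝ) (b : ℝ) (hb : 0 < b)
    (hderiv : ∀ e, ∀ y ∈ Set.Icc (0:ℝ) 1, HasDerivWithinAt (c e) (c' e y) (Set.Icc 0 1) y)
    (hc'cont : ∀ e, ContinuousOn (c' e) (Set.Icc 0 1))
    (hc'bound : ∀ e, ∀ y ∈ Set.Icc (0:ℝ) 1, 0 ≤ c' e y ∧ c' e y ≤ b)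
    (q : Fin n → Finset E → ℝ) (hq : IsProfile S q)
    (hqmin : ∀ z, IsProfile S z → potential S c q ≤ potential S c z)
    (ε : ℝ) (hε : 0 < ε)
    (x : Fin n → Finset E → ℝ) (hx : IsProfile S x)
    (hxnear : potential S c x ≤ potential S c q + ε)
    (hxpos : ∀ i s, 0 < x i s →
      Real.sqrt (ε / (2 * b * (Fintype.card E : ℝ))) ≤ x i s) :
    ∀ i, ∀ s ∈ S i, ∀ s' ∈ S i, 0 < x i s →
      pathCost S c x s
        ≤ pathCost S c x s' + Real.sqrt (8 * b * (Fintype.card E : ℝ) * ε) := by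
  intro i s hs s' hs' hxs
  obtain ⟨e0, -⟩ := hpaths i s hs
  have hm : (0:ℝ) < (Fintype.card E : ℝ) := by
    exact_mod_cast Fintype.card_pos_iff.mpr ⟨e0⟩
  set m : ℝ := (Fintype.card E : ℝ) with hmdef
  set t := Real.sqrt (ε / (2 * b * m)) with htdef
  have ht : 0 < t := Real.sqrt_pos.mpr (by positivity)
  have ht2 : t ^ 2 = ε / (2 * b * m) := Real.sq_sqrt (by positivity)
  have hε2 : ε = 2 * b * m * t ^ 2 := by rw [ht2]; field_simp
  have hsq : Real.sqrt (8 * b * m * ε) = 4 * b * m * t := by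
    rw [hε2, show 8 * b * m * (2 * b * m * t ^ 2) = (4 * b * m * t) ^ 2 by ring]
    exact Real.sqrt_sq (by positivity)
  rw [hsq]
  have hz := profile_shift S x hx i s s' hs hs' t ht.le (hxpos i s hxs)
  have hle := hqmin _ hz
  have hpot : potential S c (shift x i s s' t) ≤ potential S c x
      + t * (pathCost S c x s' - pathCost S c x s) + m * (b * t ^ 2) := by
    have hsum : potential S c (shift x i s s' t) ≤ ∑ e : E,
        ((∫ y in (0:ℝ)..(load S x e), c e y)
          + t * ((if e ∈ s' then c e (load S x e) else 0)
            - (if e ∈ s then c e (load S x e) else 0)) + b * t ^ 2) := by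
      refine Finset.sum_le_sum fun e _ => ?_
      have h := edge_bound (c e) (c' e) b (hderiv e) (hc'bound e) hb _ _
        (load_mem hn S x hx e) (load_mem hn S _ hz e)
      refine h.trans ?_
      rw [load_shift S x i s s' hs hs' t e, add_sub_cancel_left]
      have : 0 ≤ b * t ^ 2 := by positivity
      split_ifs <;> nlinarith
    refine hsum.trans (le_of_eq ?_)
    simp only [Finset.sum_add_distrib, ← Finset.mul_sum, Finset.sum_sub_distrib,
      Finset.sum_ite_mem, Finset.univ_inter, Finset.sum_const, Finset.card_univ, nsmul_eq_mul]
    simp only [potential, pathCost, hmdef]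
    ring
  have key : t * (pathCost S c x s - pathCost S c x s') ≤ t * (3 * b * m * t) := by
    nlinarith
  have key2 := le_of_mul_le_mul_left key ht
  have : 0 < b * m * t := by positivity
  linarith
end

section
/- Sandwich bound between average individual cost and potential: in a nonatomic congestion game whose edge cost functions are continuously differentiable on [0,1] with c_e(0) = 0, a·y ≤ c_e(y) ≤ b·y, and a ≤ c_e'(y) ≤ b for all y ∈ [0,1], where 0 < a ≤ b, one has for every z ∈ 𝒦: ((a+b)/b) · Φ(z) ≤ C_A(z) ≤ ((a+b)/a) · Φ(z). -/
open Finset MeasureTheory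

/-- The average individual cost `C_A(x) = Σ_{e∈E} ℓ_e(x)·c_e(ℓ_e(x))`. -/
noncomputable def avgCost {n : ℕ} {E : Type*} [Fintype E] [DecidableEq E]
    (S : Fin n → Finset (Finset E)) (c : E → ℝ → ℝ)
    (x : Fin n → Finset E → ℝ) : ℝ :=
  ∑ e : E, load S x e * c e (load S x e)

lemma edge_aux (c c' : ℝ → ℝ) (a b L : ℝ) (ha : 0 < a) (hab : a ≤ b)
    (hd : ∀ y ∈ Set.Icc (0:ℝ) 1, HasDerivWithinAt c (c' y) (Set.Icc 0 1) y)
    (hc : ContinuousOn c' (Set.Icc 0 1))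
    (hs : ∀ y ∈ Set.Icc (0:ℝ) 1, a * y ≤ c y ∧ c y ≤ b * y)
    (hb : ∀ y ∈ Set.Icc (0:ℝ) 1, a ≤ c' y ∧ c' y ≤ b)
    (h0 : 0 ≤ L) (h1 : L ≤ 1) :
    (a + b) / b * (∫ y in (0:ℝ)..L, c y) ≤ L * c L ∧
    L * c L ≤ (a + b) / a * (∫ y in (0:ℝ)..L, c y) := by
  have hbp : 0 < b := lt_of_lt_of_le ha hab
  have hsub : Set.Icc (0:ℝ) L ⊆ Set.Icc 0 1 := Set.Icc_subset_Icc_right h1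
  have hcc : ContinuousOn c (Set.Icc 0 L) :=
    fun y hy => ((hd y (hsub hy)).continuousWithinAt).mono hsub
  have hc'c : ContinuousOn c' (Set.Icc 0 L) := hc.mono hsub
  have hint : IntervalIntegrable c volume 0 L :=
    ContinuousOn.intervalIntegrable_of_Icc h0 hcc
  have hgc : ContinuousOn (fun y => c y + y * c' y) (Set.Icc 0 L) :=
    hcc.add (continuousOn_id.mul hc'c)
  have hgint : IntervalIntegrable (fun y => c y + y * c' y) volume 0 L :=
    ContinuousOn.intervalIntegrable_of_Icc h0 hgc
  have key : ∫ y in (0:ℝ)..L, (c y + y * c' y) = L * c L := by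
    have := intervalIntegral.integral_eq_sub_of_hasDerivAt_of_le (f := fun y => y * c y)
      (f' := fun y => c y + y * c' y) h0 (continuousOn_id.mul hcc) (by
        intro y hy
        have h := (hd y ⟨hy.1.le, hy.2.le.trans h1⟩).hasDerivAt
          (Icc_mem_nhds hy.1 (hy.2.trans_le h1))
        have h5 : HasDerivAt (fun y => y * c y) (1 * c y + y * c' y) y :=
          (hasDerivAt_id' y).mul h
        rw [one_mul] at h5
        exact h5) hgint
    simpa using this
  rw [← key, ← intervalIntegral.integral_const_mul, ← intervalIntegral.integral_const_mul]
  constructor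
  · refine intervalIntegral.integral_mono_on h0 (hint.const_mul _) hgint ?_
    intro y hy
    have h2 := hs y (hsub hy)
    have h3 := hb y (hsub hy)
    have h4 := mul_le_mul_of_nonneg_left h3.1 hy.1
    rw [div_mul_eq_mul_div, div_le_iff₀ hbp]
    nlinarith [mul_le_mul_of_nonneg_left h2.2 ha.le, mul_le_mul_of_nonneg_left h4 hbp.le]
  · refine intervalIntegral.integral_mono_on h0 hgint (hint.const_mul _) ?_
    intro y hy
    have h2 := hs y (hsub hy)
    have h3 := hb y (hsub hy)
    have h4 := mul_le_mul_of_nonneg_left h3.2 hy.1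
    rw [div_mul_eq_mul_div, le_div_iff₀ ha]
    nlinarith [mul_le_mul_of_nonneg_left h2.1 hbp.le, mul_le_mul_of_nonneg_left h4 ha.le]

/-- sandwich bound between the average individual cost and the potential:
for edge costs that are continuously differentiable on `[0,1]` with `c_e(0) = 0`,
`a·y ≤ c_e(y) ≤ b·y` and `a ≤ c_e'(y) ≤ b` (`0 < a ≤ b`),
`((a+b)/b)·Φ(z) ≤ C_A(z) ≤ ((a+b)/a)·Φ(z)` for every `z ∈ 𝒦`. -/
theorem avgCost_potential_sandwich
    {n : ℕ} (hn : 0 < n) {E : Type*} [Fintype E] [DecidableEq E]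
    (S : Fin n → Finset (Finset E))
    (hSne : ∀ i, (S i).Nonempty)
    (hpaths : ∀ i, ∀ s ∈ S i, s.Nonempty)
    (c c' : E → ℝ → ℝ) (a b : ℝ) (ha : 0 < a) (hab : a ≤ b)
    (hderiv : ∀ e, ∀ y ∈ Set.Icc (0:ℝ) 1, HasDerivWithinAt (c e) (c' e y) (Set.Icc 0 1) y)
    (hc'cont : ∀ e, ContinuousOn (c' e) (Set.Icc 0 1))
    (hc0 : ∀ e, c e 0 = 0)
    (hsandwich : ∀ e, ∀ y ∈ Set.Icc (0:ℝ) 1, a * y ≤ c e y ∧ c e y ≤ b * y)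
    (hc'bound : ∀ e, ∀ y ∈ Set.Icc (0:ℝ) 1, a ≤ c' e y ∧ c' e y ≤ b)
    (z : Fin n → Finset E → ℝ) (hz : IsProfile S z) :
    (a + b) / b * potential S c z ≤ avgCost S c z ∧
    avgCost S c z ≤ (a + b) / a * potential S c z := by
  have hL0 : ∀ e, 0 ≤ load S z e := fun e =>
    Finset.sum_nonneg fun i _ => Finset.sum_nonneg fun s _ => hz.1 i s
  have hL1 : ∀ e, load S z e ≤ 1 := by
    intro e
    have hn' : (n:ℝ) ≠ 0 := by exact_mod_cast hn.ne'
    calc load S z e ≤ ∑ i : Fin n, ∑ s ∈ S i, z i s :=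
          Finset.sum_le_sum fun i _ =>
            Finset.sum_le_sum_of_subset_of_nonneg (Finset.filter_subset _ _)
              fun s _ _ => hz.1 i s
      _ = 1 := by
          rw [Finset.sum_congr rfl fun i _ => hz.2.2 i]
          simp [hn']
  have H := fun e => edge_aux (c e) (c' e) a b (load S z e) ha hab (hderiv e) (hc'cont e)
    (hsandwich e) (hc'bound e) (hL0 e) (hL1 e)
  unfold potential avgCost
  rw [Finset.mul_sum, Finset.mul_sum]
  exact ⟨Finset.sum_le_sum fun e _ => (H e).1, Finset.sum_le_sum fun e _ => (H e).2⟩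
end

section
/- Average-cost guarantee at near-minimizers of the potential: in a nonatomic congestion game whose edge cost functions are continuously differentiable on [0,1] with c_e(0) = 0, a·y ≤ c_e(y) ≤ b·y, and a ≤ c_e'(y) ≤ b for all y ∈ [0,1] (0 < a ≤ b), let q minimize Φ over 𝒦 and let x* minimize C_A over 𝒦. Then every x ∈ 𝒦 with Φ(x) ≤ Φ(q) + ε satisfies C_A(x)/C_A(x*) ≤ (b/a) · (1 + 2mε/a). -/
open Finset MeasureTheory

lemma edge_bounds (c c' : ℝ → ℝ) (a b : ℝ) (ha : 0 < a) (hab : a ≤ b)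
    (hderiv : ∀ y ∈ Set.Icc (0:ℝ) 1, HasDerivWithinAt c (c' y) (Set.Icc 0 1) y)
    (hc'cont : ContinuousOn c' (Set.Icc 0 1))
    (hs : ∀ y ∈ Set.Icc (0:ℝ) 1, a * y ≤ c y ∧ c y ≤ b * y)
    (hb : ∀ y ∈ Set.Icc (0:ℝ) 1, a ≤ c' y ∧ c' y ≤ b)
    (l : ℝ) (hl : l ∈ Set.Icc (0:ℝ) 1) :
    a * (l * c l) ≤ (a + b) * (∫ y in (0:ℝ)..l, c y) ∧
    (a + b) * (∫ y in (0:ℝ)..l, c y) ≤ b * (l * c l) := by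
  obtain ⟨h0, h1⟩ := hl
  have hsub : Set.Icc 0 l ⊆ Set.Icc (0:ℝ) 1 := Set.Icc_subset_Icc le_rfl h1
  have hc : ContinuousOn c (Set.Icc 0 l) :=
    fun y hy => ((hderiv y (hsub hy)).continuousWithinAt).mono hsub
  have hc' : ContinuousOn c' (Set.Icc 0 l) := hc'cont.mono hsub
  have hg : ContinuousOn (fun y => c y + y * c' y) (Set.Icc 0 l) :=
    hc.add (continuousOn_id.mul hc')
  have ic : IntervalIntegrable c volume 0 l := hc.intervalIntegrable_of_Icc h0
  have ig : IntervalIntegrable (fun y => c y + y * c' y) volume 0 l :=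
    hg.intervalIntegrable_of_Icc h0
  have ftc : ∫ y in (0:ℝ)..l, (c y + y * c' y) = l * c l := by
    have := intervalIntegral.integral_eq_sub_of_hasDerivAt_of_le (f := fun y => y * c y) h0
      (continuousOn_id.mul hc) (fun y hy => by
        have hd : HasDerivAt c (c' y) y :=
          (hderiv y (hsub ⟨hy.1.le, hy.2.le⟩)).hasDerivAt
            (Icc_mem_nhds hy.1 (lt_of_lt_of_le hy.2 h1))
        have := (hasDerivAt_id y).mul hd
        simp only [id, one_mul] at this
        exact this) ig
    simpa using this
  rw [← ftc, ← intervalIntegral.integral_const_mul, ← intervalIntegral.integral_const_mul,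
    ← intervalIntegral.integral_const_mul]
  constructor
  · apply intervalIntegral.integral_mono_on h0 (ig.const_mul a) (ic.const_mul (a+b))
    intro y hy
    have h2 := hs y (hsub hy)
    have h3 := hb y (hsub hy)
    have hy0 := hy.1
    have e1 : a * y * c' y ≤ a * y * b := mul_le_mul_of_nonneg_left h3.2 (by positivity)
    have e2 : b * (a * y) ≤ b * c y := mul_le_mul_of_nonneg_left h2.1 (by linarith)
    linarith
  · apply intervalIntegral.integral_mono_on h0 (ic.const_mul (a+b)) (ig.const_mul b)
    intro y hy
    have h2 := hs y (hsub hy)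
    have h3 := hb y (hsub hy)
    have hy0 := hy.1
    have hb0 : 0 < b := by linarith
    have e1 : b * y * a ≤ b * y * c' y := mul_le_mul_of_nonneg_left h3.1 (by positivity)
    have e2 : a * c y ≤ a * (b * y) := mul_le_mul_of_nonneg_left h2.2 ha.le
    linarith

lemma one_le_sum_load {n : ℕ} (hn : 0 < n) {E : Type*} [Fintype E] [DecidableEq E]
    (S : Fin n → Finset (Finset E)) (hpaths : ∀ i, ∀ s ∈ S i, s.Nonempty)
    (x : Fin n → Finset E → ℝ) (hx : IsProfile S x) :
    1 ≤ ∑ e, load S x e := by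
  obtain ⟨h1, -, h3⟩ := hx
  have hn' : (n:ℝ) ≠ 0 := by positivity
  unfold load
  rw [Finset.sum_comm]
  calc (1:ℝ) = ∑ i : Fin n, ∑ s ∈ S i, x i s := by simp [h3, hn']
    _ ≤ _ := Finset.sum_le_sum fun i _ => ?_
  simp only [Finset.sum_filter]
  rw [Finset.sum_comm]
  refine Finset.sum_le_sum fun s hs => ?_
  obtain ⟨e, he⟩ := hpaths i s hs
  have := Finset.single_le_sum (f := fun e => if e ∈ s then x i s else 0) (s := Finset.univ)
    (fun e _ => by split_ifs; exacts [h1 i s, le_rfl]) (Finset.mem_univ e)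
  simpa only [he, if_true] using this

/-- average-cost guarantee at near-minimizers of the potential.
With `0 < a ≤ b`, `c_e(0) = 0`, `a·y ≤ c_e(y) ≤ b·y`, `a ≤ c_e'(y) ≤ b` on `[0,1]`,
`q` minimizing `Φ` and `x*` minimizing `C_A` over `𝒦`, every `x ∈ 𝒦` with
`Φ(x) ≤ Φ(q) + ε` satisfies `C_A(x)/C_A(x*) ≤ (b/a)·(1 + 2mε/a)`, `m = |E|`. -/
theorem avgCost_near_minimizer
    {n : ℕ} (hn : 0 < n) {E : Type*} [Fintype E] [DecidableEq E]
    (S : Fin n → Finset (Finset E))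
    (hSne : ∀ i, (S i).Nonempty)
    (hpaths : ∀ i, ∀ s ∈ S i, s.Nonempty)
    (c c' : E → ℝ → ℝ) (a b : ℝ) (ha : 0 < a) (hab : a ≤ b)
    (hderiv : ∀ e, ∀ y ∈ Set.Icc (0:ℝ) 1, HasDerivWithinAt (c e) (c' e y) (Set.Icc 0 1) y)
    (hc'cont : ∀ e, ContinuousOn (c' e) (Set.Icc 0 1))
    (hc0 : ∀ e, c e 0 = 0)
    (hsandwich : ∀ e, ∀ y ∈ Set.Icc (0:ℝ) 1, a * y ≤ c e y ∧ c e y ≤ b * y)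
    (hc'bound : ∀ e, ∀ y ∈ Set.Icc (0:ℝ) 1, a ≤ c' e y ∧ c' e y ≤ b)
    (q : Fin n → Finset E → ℝ) (hq : IsProfile S q)
    (hqmin : ∀ z, IsProfile S z → potential S c q ≤ potential S c z)
    (xstar : Fin n → Finset E → ℝ) (hxstar : IsProfile S xstar)
    (hxstarmin : ∀ z, IsProfile S z → avgCost S c xstar ≤ avgCost S c z)
    (ε : ℝ) (hε : 0 ≤ ε)
    (x : Fin n → Finset E → ℝ) (hx : IsProfile S x)
    (hxnear : potential S c x ≤ potential S c q + ε) :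
    avgCost S c x / avgCost S c xstar
      ≤ b / a * (1 + 2 * (Fintype.card E : ℝ) * ε / a) := by
  have hb0 : 0 < b := by linarith
  have hlo : ∀ z, IsProfile S z → a * avgCost S c z ≤ (a + b) * potential S c z := by
    intro z hz
    unfold avgCost potential
    rw [Finset.mul_sum, Finset.mul_sum]
    exact Finset.sum_le_sum fun e _ => (edge_bounds (c e) (c' e) a b ha hab (hderiv e)
      (hc'cont e) (hsandwich e) (hc'bound e) _ (load_mem hn S z hz e)).1
  have hhi : ∀ z, IsProfile S z → (a + b) * potential S c z ≤ b * avgCost S c z := by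
    intro z hz
    unfold avgCost potential
    rw [Finset.mul_sum, Finset.mul_sum]
    exact Finset.sum_le_sum fun e _ => (edge_bounds (c e) (c' e) a b ha hab (hderiv e)
      (hc'cont e) (hsandwich e) (hc'bound e) _ (load_mem hn S z hz e)).2
  have hsum := one_le_sum_load hn S hpaths xstar hxstar
  have hcs : (∑ e, load S xstar e) ^ 2 ≤ (Fintype.card E : ℝ) * ∑ e, load S xstar e ^ 2 := by
    simpa using sq_sum_le_card_mul_sum_sq (s := Finset.univ) (f := load S xstar)
  have hsq : a * ∑ e, load S xstar e ^ 2 ≤ avgCost S c xstar := by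
    unfold avgCost
    rw [Finset.mul_sum]
    refine Finset.sum_le_sum fun e _ => ?_
    have hm := load_mem hn S xstar hxstar e
    have := mul_le_mul_of_nonneg_left (hsandwich e _ hm).1 hm.1
    linarith
  have hm0 : (0:ℝ) ≤ Fintype.card E := by positivity
  have hmC : a ≤ (Fintype.card E : ℝ) * avgCost S c xstar := by
    have h1 : 1 ≤ (Fintype.card E : ℝ) * ∑ e, load S xstar e ^ 2 := by nlinarith
    have h2 := mul_le_mul_of_nonneg_left hsq hm0
    have h3 := mul_le_mul_of_nonneg_left h1 ha.le
    linarith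
  have hC : 0 < avgCost S c xstar := by
    by_contra! h
    have := mul_nonpos_of_nonneg_of_nonpos hm0 h
    linarith
  have hmain : a * avgCost S c x ≤ b * avgCost S c xstar + (a + b) * ε := by
    have h1 := hlo x hx
    have h2 := hhi xstar hxstar
    have h3 : (a + b) * potential S c x ≤ (a + b) * (potential S c xstar + ε) :=
      mul_le_mul_of_nonneg_left (by linarith [hqmin xstar hxstar]) (by linarith)
    linarith
  have h4 : (a + b) * ε ≤ 2 * b * ε := mul_le_mul_of_nonneg_right (by linarith) hε
  have h5 : 2 * b * ε * a ≤ 2 * b * ε * ((Fintype.card E : ℝ) * avgCost S c xstar) :=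
    mul_le_mul_of_nonneg_left hmC (by positivity)
  rw [div_le_iff₀ hC]
  have h6 : b / a * (1 + 2 * (Fintype.card E : ℝ) * ε / a) * avgCost S c xstar
      = (b * avgCost S c xstar * a + 2 * b * ε * ((Fintype.card E : ℝ) * avgCost S c xstar))
        / (a * a) := by
    field_simp
  rw [h6, le_div_iff₀ (by positivity)]
  have h7 := mul_le_mul_of_nonneg_right (hmain.trans (add_le_add_right h4 _)) ha.le
  linarith
end

section
/- Convergence time of multiplicative-updates dynamics in nonatomic congestion games: consider a nonatomic congestion game of n players whose edge cost functions are continuously differentiable on [0,1] with c_e(0) = 0 and 0 ≤ c_e'(y) ≤ b, and in which every path of 𝒮_i intersects at most k paths of 𝒮_i (counting itself); set λ = bmk and d = Σ_{i∈N}|𝒮_i|. Suppose each player i starts from the uniform strategy x⁰_{i,s} = 1/(n|𝒮_i|) for all s ∈ 𝒮_i, and updates x_i^{t+1} = argmin_{z∈𝒦_i} { η_i ⟨(c_s(x^t))_{s∈𝒮_i}, z⟩ + Σ_{s∈𝒮_i} z_s ln(z_s / x^t_{i,s}) } (the multiplicative-updates / entropic mirror-descent rule) with η ≤ η_i ≤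 1/λ. Then for every ε ∈ (0,1), for all integers t ≥ n·ln(dn)/(ηε) one has Φ(x^t) ≤ Φ(q) + ε, where q minimizes Φ over 𝒦. -/
open Finset MeasureTheory

/-- The feasible strategy set `𝒦_i` of player `i`. -/
def Ki {n : ℕ} {E : Type*} [Fintype E] [DecidableEq E]
    (S : Fin n → Finset (Finset E)) (i : Fin n) : Set (Finset E → ℝ) :=
  {z | (∀ s, 0 ≤ z s) ∧ (∀ s ∉ S i, z s = 0) ∧ ∑ s ∈ S i, z s = 1 / (n:ℝ)}

lemma cmu_point (y x : ℝ) (hy : 0 ≤ y) (hx : 0 < x) :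
    (√y - √x) ^ 2 ≤ y * Real.log (y / x) - y + x := by
  have h1 := Real.sq_sqrt hy
  have h2 := Real.sq_sqrt hx.le
  rcases hy.eq_or_lt with h | h
  · subst h; simp [h2]
  have hsy : 0 < √y := Real.sqrt_pos.2 h
  have hsx : 0 < √x := Real.sqrt_pos.2 hx
  have h3 : Real.log (√x / √y) ≤ √x / √y - 1 := Real.log_le_sub_one_of_pos (by positivity)
  have h4 : Real.log (y / x) = -2 * Real.log (√x / √y) := by
    rw [Real.log_div h.ne' hx.ne', Real.log_div hsx.ne' hsy.ne', Real.log_sqrt hy,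
      Real.log_sqrt hx.le]
    ring
  have h5 : y * (√x / √y) = √y * √x := by
    rw [mul_div_assoc', div_eq_iff hsy.ne']
    linear_combination (-√x) * h1
  rw [h4]
  have := mul_le_mul_of_nonneg_left h3 hy
  nlinarith

lemma cmu_hell {α : Type*} (A : Finset α) (y x : α → ℝ) (M : ℝ) (hy : ∀ s ∈ A, 0 ≤ y s)
    (hx : ∀ s ∈ A, 0 < x s) (hyM : ∑ s ∈ A, y s = M) (hxM : ∑ s ∈ A, x s = M) :
    ∑ s ∈ A, (√(y s) - √(x s)) ^ 2 ≤ ∑ s ∈ A, y s * Real.log (y s / x s) := by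
  have := Finset.sum_le_sum (fun s hs => cmu_point (y s) (x s) (hy s hs) (hx s hs))
  rw [Finset.sum_add_distrib, Finset.sum_sub_distrib] at this
  linarith

lemma cmu_eq {α : Type*} (A : Finset α) (y x : α → ℝ) (M : ℝ) (hy : ∀ s ∈ A, 0 ≤ y s)
    (hx : ∀ s ∈ A, 0 < x s) (hyM : ∑ s ∈ A, y s = M) (hxM : ∑ s ∈ A, x s = M)
    (h : ∑ s ∈ A, y s * Real.log (y s / x s) ≤ 0) : ∀ s ∈ A, y s = x s := by
  intro s hs
  have h1 := (cmu_hell A y x M hy hx hyM hxM).trans h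
  have h2 : (√(y s) - √(x s)) ^ 2 ≤ 0 :=
    (Finset.single_le_sum (f := fun s => (√(y s) - √(x s)) ^ 2)
      (fun _ _ => sq_nonneg _) hs).trans h1
  have h3 : √(y s) - √(x s) = 0 := by
    have := sq_nonneg (√(y s) - √(x s)); exact pow_eq_zero_iff (two_ne_zero) |>.1 (le_antisymm h2 this)
  have h5 := Real.sq_sqrt (hy s hs)
  have h6 := Real.sq_sqrt (hx s hs).le
  have h4 : √(y s) = √(x s) := by linarith
  rw [h4] at h5
  linarith

lemma cmu_l1 {α : Type*} (A : Finset α) (y x : α → ℝ) (M : ℝ) (hy : ∀ s ∈ A, 0 ≤ y s)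
    (hx : ∀ s ∈ A, 0 < x s) (hyM : ∑ s ∈ A, y s = M) (hxM : ∑ s ∈ A, x s = M) :
    (∑ s ∈ A, |y s - x s|) ^ 2 ≤ 4 * M * ∑ s ∈ A, y s * Real.log (y s / x s) := by
  have hM : 0 ≤ M := hyM ▸ Finset.sum_nonneg hy
  have h1 := cmu_hell A y x M hy hx hyM hxM
  have h2 := Finset.sum_mul_sq_le_sq_mul_sq A (fun s => |√(y s) - √(x s)|) (fun s => √(y s) + √(x s))
  have h3 : ∑ s ∈ A, |√(y s) - √(x s)| * (√(y s) + √(x s)) = ∑ s ∈ A, |y s - x s| := by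
    refine Finset.sum_congr rfl fun s hs => ?_
    have h0 : 0 ≤ √(y s) + √(x s) := by positivity
    have h0' : |√(y s) - √(x s)| * (√(y s) + √(x s))
        = |(√(y s) - √(x s)) * (√(y s) + √(x s))| := by rw [abs_mul, abs_of_nonneg h0]
    rw [h0']
    congr 1
    nlinarith [Real.sq_sqrt (hy s hs), Real.sq_sqrt (hx s hs).le]
  have h4 : ∑ s ∈ A, (√(y s) + √(x s)) ^ 2 ≤ 4 * M := by
    calc _ ≤ ∑ s ∈ A, (2 * y s + 2 * x s) := Finset.sum_le_sum fun s hs => by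
          nlinarith [Real.sq_sqrt (hy s hs), Real.sq_sqrt (hx s hs).le, sq_nonneg (√(y s) - √(x s))]
      _ = _ := by rw [Finset.sum_add_distrib, ← Finset.mul_sum, ← Finset.mul_sum, hyM, hxM]; ring
  simp only [h3, sq_abs] at h2
  have h5 : 0 ≤ ∑ s ∈ A, (√(y s) - √(x s)) ^ 2 := Finset.sum_nonneg fun _ _ => sq_nonneg _
  calc _ ≤ _ := h2
    _ ≤ (∑ s ∈ A, (√(y s) - √(x s)) ^ 2) * (4 * M) := mul_le_mul_of_nonneg_left h4 h5
    _ ≤ _ := by rw [mul_comm]; exact mul_le_mul_of_nonneg_left h1 (by positivity)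

lemma cmu_sub {α : Type*} (A : Finset α) (p : α → Prop) [DecidablePred p] (y x : α → ℝ) (M : ℝ)
    (hy : ∀ s ∈ A, 0 ≤ y s)
    (hx : ∀ s ∈ A, 0 < x s) (hyM : ∑ s ∈ A, y s = M) (hxM : ∑ s ∈ A, x s = M) :
    (∑ s ∈ A.filter p, y s - ∑ s ∈ A.filter p, x s) ^ 2
      ≤ M * ∑ s ∈ A, y s * Real.log (y s / x s) := by
  have h := cmu_l1 A y x M hy hx hyM hxM
  have e1 := Finset.sum_filter_add_sum_filter_not A p y
  have e2 := Finset.sum_filter_add_sum_filter_not A p x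
  have e3 := Finset.sum_filter_add_sum_filter_not A p (fun s => |y s - x s|)
  have a1 := Finset.abs_sum_le_sum_abs (fun s => y s - x s) (A.filter p)
  have a2 := Finset.abs_sum_le_sum_abs (fun s => y s - x s) (A.filter (fun s => ¬ p s))
  rw [Finset.sum_sub_distrib] at a1 a2
  have e4 : ∑ s ∈ A.filter (fun s => ¬ p s), y s - ∑ s ∈ A.filter (fun s => ¬ p s), x s
      = -(∑ s ∈ A.filter p, y s - ∑ s ∈ A.filter p, x s) := by linarith
  rw [e4, abs_neg] at a2
  set D := ∑ s ∈ A.filter p, y s - ∑ s ∈ A.filter p, x s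
  have h6 : 2 * |D| ≤ ∑ s ∈ A, |y s - x s| := by linarith
  have h7 : (2 * |D|) ^ 2 ≤ (∑ s ∈ A, |y s - x s|) ^ 2 := pow_le_pow_left₀ (by positivity) h6 2
  rw [mul_pow, sq_abs] at h7
  linarith

lemma cmu_three {α : Type*} [DecidableEq α] (A : Finset α) (hA : A.Nonempty) (x x' g : α → ℝ)
    (M : ℝ) (hM : 0 < M)
    (hx : ∀ s ∈ A, 0 < x s) (hx' : ∀ s ∈ A, 0 ≤ x' s) (hx'M : ∑ s ∈ A, x' s = M)
    (hopt : ∀ z : α → ℝ, (∀ s, 0 ≤ z s) → (∀ s ∉ A, z s = 0) → ∑ s ∈ A, z s = M →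
      ∑ s ∈ A, g s * x' s + ∑ s ∈ A, x' s * Real.log (x' s / x s)
        ≤ ∑ s ∈ A, g s * z s + ∑ s ∈ A, z s * Real.log (z s / x s)) :
    (∀ s ∈ A, 0 < x' s) ∧ ∀ z : α → ℝ, (∀ s ∈ A, 0 ≤ z s) → ∑ s ∈ A, z s = M →
      ∑ s ∈ A, g s * x' s + ∑ s ∈ A, x' s * Real.log (x' s / x s)
        + ∑ s ∈ A, z s * Real.log (z s / x' s)
        ≤ ∑ s ∈ A, g s * z s + ∑ s ∈ A, z s * Real.log (z s / x s) := by
  set W := ∑ s ∈ A, x s * Real.exp (-g s) with hW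
  have hWpos : 0 < W := Finset.sum_pos (fun s hs => mul_pos (hx s hs) (Real.exp_pos _)) hA
  set w : α → ℝ := fun s => if s ∈ A then M / W * (x s * Real.exp (-g s)) else 0 with hw
  have hwA : ∀ s ∈ A, w s = M / W * (x s * Real.exp (-g s)) := fun s hs => by simp [hw, hs]
  have hwpos : ∀ s ∈ A, 0 < w s := fun s hs => by
    rw [hwA s hs]; have := hx s hs; positivity
  have hw0 : ∀ s ∉ A, w s = 0 := fun s hs => by simp [hw, hs]
  have hwM : ∑ s ∈ A, w s = M := by
    rw [Finset.sum_congr rfl hwA, ← Finset.mul_sum, ← hW]; field_simp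
  have key : ∀ z : α → ℝ, (∀ s ∈ A, 0 ≤ z s) → ∑ s ∈ A, z s = M →
      ∑ s ∈ A, g s * z s + ∑ s ∈ A, z s * Real.log (z s / x s)
        = ∑ s ∈ A, z s * Real.log (z s / w s) + M * Real.log (M / W) := by
    intro z hz hzM
    rw [← hzM, Finset.sum_mul, ← Finset.sum_add_distrib, ← Finset.sum_add_distrib, hzM]
    refine Finset.sum_congr rfl fun s hs => ?_
    rcases (hz s hs).eq_or_lt with h | h
    · simp [← h]
    · rw [Real.log_div h.ne' (hx s hs).ne', Real.log_div h.ne' (hwpos s hs).ne', hwA s hs,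
        Real.log_mul (by positivity) (mul_pos (hx s hs) (Real.exp_pos _)).ne',
        Real.log_mul (hx s hs).ne' (Real.exp_pos _).ne', Real.log_exp]
      ring
  have hself : ∑ s ∈ A, w s * Real.log (w s / w s) = 0 :=
    Finset.sum_eq_zero fun s hs => by rw [div_self (hwpos s hs).ne']; simp
  have hle := hopt w (fun s => by
    by_cases hs : s ∈ A
    · exact (hwpos s hs).le
    · exact (hw0 s hs).ge) hw0 hwM
  rw [key x' hx' hx'M, key w (fun s hs => (hwpos s hs).le) hwM, hself] at hle
  have heq := cmu_eq A x' w M hx' hwpos hx'M hwM (by linarith)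
  refine ⟨fun s hs => heq s hs ▸ hwpos s hs, fun z hz hzM => ?_⟩
  rw [key x' hx' hx'M, key z hz hzM]
  have e1 : ∑ s ∈ A, x' s * Real.log (x' s / w s) = 0 := by
    rw [← hself]; exact Finset.sum_congr rfl fun s hs => by rw [heq s hs]
  have e2 : ∑ s ∈ A, z s * Real.log (z s / x' s) = ∑ s ∈ A, z s * Real.log (z s / w s) :=
    Finset.sum_congr rfl fun s hs => by rw [heq s hs]
  linarith

lemma cmu_int (c c' : ℝ → ℝ) (b : ℝ)
    (hderiv : ∀ y ∈ Set.Icc (0:ℝ) 1, HasDerivWithinAt c (c' y) (Set.Icc 0 1) y)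
    (hb : ∀ y ∈ Set.Icc (0:ℝ) 1, 0 ≤ c' y ∧ c' y ≤ b) (u v : ℝ)
    (hu : u ∈ Set.Icc (0:ℝ) 1) (hv : v ∈ Set.Icc (0:ℝ) 1) :
    c u * (v - u) ≤ (∫ y in (0:ℝ)..v, c y) - ∫ y in (0:ℝ)..u, c y ∧
    (∫ y in (0:ℝ)..v, c y) - (∫ y in (0:ℝ)..u, c y) ≤ c u * (v - u) + b * (v - u) ^ 2 := by
  have hcont : ContinuousOn c (Set.Icc 0 1) := fun y hy => (hderiv y hy).continuousWithinAt
  have hdw : ∀ y ∈ interior (Set.Icc (0:ℝ) 1), HasDerivAt c (c' y) y := fun y hy =>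
    (hderiv y (interior_subset hy)).hasDerivAt (mem_interior_iff_mem_nhds.1 hy)
  have hmono : MonotoneOn c (Set.Icc 0 1) := by
    refine monotoneOn_of_deriv_nonneg (convex_Icc 0 1) hcont
      (fun y hy => (hdw y hy).differentiableAt.differentiableWithinAt) fun y hy => ?_
    rw [(hdw y hy).deriv]; exact (hb y (interior_subset hy)).1
  have hlip : ∀ p ∈ Set.Icc (0:ℝ) 1, ∀ r ∈ Set.Icc (0:ℝ) 1, p ≤ r → c r - c p ≤ b * (r - p) := by
    refine (convex_Icc 0 1).image_sub_le_mul_sub_of_deriv_le hcont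
      (fun y hy => (hdw y hy).differentiableAt.differentiableWithinAt) fun y hy => ?_
    rw [(hdw y hy).deriv]; exact (hb y (interior_subset hy)).2
  have hii : ∀ p ∈ Set.Icc (0:ℝ) 1, ∀ r ∈ Set.Icc (0:ℝ) 1, IntervalIntegrable c MeasureTheory.volume p r :=
    fun p hp r hr => (hcont.mono (Set.uIcc_subset_Icc hp hr)).intervalIntegrable
  have h0 : (0:ℝ) ∈ Set.Icc (0:ℝ) 1 := by simp
  rw [intervalIntegral.integral_interval_sub_left (hii 0 h0 v hv) (hii 0 h0 u hu)]
  have bd : ∀ p ∈ Set.Icc (0:ℝ) 1, ∀ r ∈ Set.Icc (0:ℝ) 1, p ≤ r →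
      c p * (r - p) ≤ (∫ y in p..r, c y) ∧ (∫ y in p..r, c y) ≤ c r * (r - p) := by
    intro p hp r hr hpr
    have m1 := intervalIntegral.integral_mono_on (f := fun _ => c p) hpr (by simp) (hii p hp r hr)
      fun y hy => hmono hp ⟨hp.1.trans hy.1, hy.2.trans hr.2⟩ hy.1
    have m2 := intervalIntegral.integral_mono_on (g := fun _ => c r) hpr (hii p hp r hr) (by simp)
      fun y hy => hmono ⟨hp.1.trans hy.1, hy.2.trans hr.2⟩ hr hy.2
    simp only [intervalIntegral.integral_const, smul_eq_mul] at m1 m2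
    constructor <;> linarith
  rcases le_total u v with h | h
  · have := bd u hu v hv h
    have := hlip u hu v hv h
    constructor
    · linarith
    · nlinarith
  · have := bd v hv u hu h
    have := hlip v hv u hu h
    rw [intervalIntegral.integral_symm]
    constructor
    · linarith
    · nlinarith

section
variable {n : ℕ} {E : Type*} [Fintype E] [DecidableEq E] (S : Fin n → Finset (Finset E))

lemma cmu_load_mem (hn : 0 < n) (z : Fin n → Finset E → ℝ) (hz : ∀ i, z i ∈ Ki S i) (e : E) :
    load S z e ∈ Set.Icc (0:ℝ) 1 := by
  constructor
  · exact Finset.sum_nonneg fun i _ => Finset.sum_nonneg fun s _ => (hz i).1 s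
  · calc load S z e ≤ ∑ i : Fin n, (1 / (n:ℝ)) := by
          refine Finset.sum_le_sum fun i _ => ?_
          rw [← (hz i).2.2]
          exact Finset.sum_le_sum_of_subset_of_nonneg (Finset.filter_subset _ _)
            fun s _ _ => (hz i).1 s
      _ = 1 := by
          have : (n:ℝ) ≠ 0 := by positivity
          simp [this]

lemma cmu_pc (c : E → ℝ → ℝ) (x z : Fin n → Finset E → ℝ) :
    ∑ i, ∑ s ∈ S i, pathCost S c x s * z i s = ∑ e, c e (load S x e) * load S z e := by
  have h1 : ∀ i, ∑ s ∈ S i, pathCost S c x s * z i s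
      = ∑ e, c e (load S x e) * ∑ s ∈ (S i).filter (fun s => e ∈ s), z i s := by
    intro i
    simp only [pathCost, Finset.mul_sum, Finset.sum_filter, Finset.sum_mul]
    rw [Finset.sum_comm]
    refine Finset.sum_congr rfl fun s _ => ?_
    simp only [mul_ite, mul_zero]
    rw [← Finset.sum_filter]
    simp
  simp only [h1]
  rw [Finset.sum_comm]
  simp only [load, Finset.mul_sum]

lemma cmu_phi (hn : 0 < n) (c c' : E → ℝ → ℝ) (b : ℝ)
    (hderiv : ∀ e, ∀ y ∈ Set.Icc (0:ℝ) 1, HasDerivWithinAt (c e) (c' e y) (Set.Icc 0 1) y)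
    (hc'bound : ∀ e, ∀ y ∈ Set.Icc (0:ℝ) 1, 0 ≤ c' e y ∧ c' e y ≤ b)
    (x z : Fin n → Finset E → ℝ) (hx : ∀ i, x i ∈ Ki S i) (hz : ∀ i, z i ∈ Ki S i) :
    (∑ i, ∑ s ∈ S i, pathCost S c x s * z i s) - (∑ i, ∑ s ∈ S i, pathCost S c x s * x i s)
      ≤ potential S c z - potential S c x ∧
    potential S c z - potential S c x ≤
      (∑ i, ∑ s ∈ S i, pathCost S c x s * z i s) - (∑ i, ∑ s ∈ S i, pathCost S c x s * x i s)
      + b * ∑ e, (load S z e - load S x e) ^ 2 := by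
  have h := fun e => cmu_int (c e) (c' e) b (hderiv e) (hc'bound e) (load S x e) (load S z e)
    (cmu_load_mem S hn x hx e) (cmu_load_mem S hn z hz e)
  rw [cmu_pc, cmu_pc]
  simp only [potential, Finset.mul_sum, ← Finset.sum_sub_distrib, ← Finset.sum_add_distrib]
  constructor
  · exact Finset.sum_le_sum fun e _ => by have := (h e).1; linarith
  · exact Finset.sum_le_sum fun e _ => by have := (h e).2; linarith

lemma cmu_loadsq (hn : 0 < n) (x z : Fin n → Finset E → ℝ) (hx : ∀ i, x i ∈ Ki S i)
    (hxp : ∀ i, ∀ s ∈ S i, 0 < x i s) (hz : ∀ i, z i ∈ Ki S i) :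
    ∑ e, (load S z e - load S x e) ^ 2
      ≤ (Fintype.card E : ℝ) * ∑ i, ∑ s ∈ S i, z i s * Real.log (z i s / x i s) := by
  have hn' : (n:ℝ) ≠ 0 := by positivity
  have h : ∀ e ∈ (Finset.univ : Finset E), (load S z e - load S x e) ^ 2
      ≤ ∑ i, ∑ s ∈ S i, z i s * Real.log (z i s / x i s) := by
    intro e _
    simp only [load, ← Finset.sum_sub_distrib]
    refine (sq_sum_le_card_mul_sum_sq (s := (Finset.univ : Finset (Fin n)))).trans ?_
    simp only [Finset.card_univ, Fintype.card_fin, Finset.mul_sum (s := Finset.univ)]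
    refine Finset.sum_le_sum fun i _ => ?_
    have := cmu_sub (S i) (fun s => e ∈ s) (z i) (x i) (1 / (n:ℝ)) (fun s _ => (hz i).1 s)
      (hxp i) (hz i).2.2 (hx i).2.2
    rw [← Finset.sum_sub_distrib] at this
    calc _ ≤ (n:ℝ) * (1 / (n:ℝ) * ∑ s ∈ S i, z i s * Real.log (z i s / x i s)) :=
          mul_le_mul_of_nonneg_left this (by positivity)
      _ = _ := by field_simp
  have := Finset.sum_le_card_nsmul _ _ _ h
  simpa using this

lemma cmu_kl0 (hn : 0 < n) (hSne : ∀ i, (S i).Nonempty) (i : Fin n) (x0 q : Finset E → ℝ)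
    (hx0 : ∀ s, x0 s = if s ∈ S i then 1 / ((n : ℝ) * (S i).card) else 0) (hq : q ∈ Ki S i) :
    ∑ s ∈ S i, q s * Real.log (q s / x0 s) ≤ 1 / (n:ℝ) * Real.log ((S i).card) := by
  have hn' : (0:ℝ) < n := by positivity
  have hc : (0:ℝ) < (S i).card := by exact_mod_cast (hSne i).card_pos
  have h : ∀ s ∈ S i, q s * Real.log (q s / x0 s) ≤ q s * Real.log ((S i).card) := by
    intro s hs
    have hq1 : q s ≤ 1 / n := by
      rw [← hq.2.2]; exact Finset.single_le_sum (f := q) (fun s _ => hq.1 s) hs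
    rcases (hq.1 s).eq_or_lt with h | h
    · simp [← h]
    · refine mul_le_mul_of_nonneg_left (Real.log_le_log ?_ ?_) h.le
      · rw [hx0, if_pos hs]; positivity
      · rw [hx0, if_pos hs, div_le_iff₀ (by positivity)]
        refine hq1.trans (le_of_eq ?_)
        field_simp
  refine (Finset.sum_le_sum h).trans ?_
  rw [← Finset.sum_mul, hq.2.2]

end

/-- convergence time of multiplicative-updates dynamics in nonatomic
congestion games.  With `C¹` edge costs satisfying `c_e(0) = 0` and `0 ≤ c_e' ≤ b`, each
player's path intersecting at most `k` of her paths, `λ = bmk` (`m = |E|`) and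
`d = Σ_i |𝒮_i|`, each player starting from the uniform strategy and running the entropic
mirror-descent (multiplicative-updates) rule with step size `η ≤ η_i ≤ 1/λ`, for every
`ε ∈ (0,1)` and every `t ≥ n·ln(dn)/(ηε)` one has `Φ(x^t) ≤ Φ(q) + ε`, where `q`
minimizes `Φ` over `𝒦`. -/
theorem congestion_multiplicative_updates_converges
    {n : ℕ} (hn : 0 < n) {E : Type*} [Fintype E] [DecidableEq E]
    (S : Fin n → Finset (Finset E))
    (hSne : ∀ i, (S i).Nonempty)
    (hpaths : ∀ i, ∀ s ∈ S i, s.Nonempty)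
    (c c' : E → ℝ → ℝ) (b : ℝ) (hb : 0 < b) (k : ℕ) (hk : 0 < k)
    (hderiv : ∀ e, ∀ y ∈ Set.Icc (0:ℝ) 1, HasDerivWithinAt (c e) (c' e y) (Set.Icc 0 1) y)
    (hc'cont : ∀ e, ContinuousOn (c' e) (Set.Icc 0 1))
    (hc0 : ∀ e, c e 0 = 0)
    (hc'bound : ∀ e, ∀ y ∈ Set.Icc (0:ℝ) 1, 0 ≤ c' e y ∧ c' e y ≤ b)
    (hkcap : ∀ i, ∀ s ∈ S i, ((S i).filter (fun r => (s ∩ r).Nonempty)).card ≤ k)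
    (lam : ℝ) (hlam : lam = b * (Fintype.card E : ℝ) * k)
    (d : ℕ) (hd : d = ∑ i, (S i).card)
    (q : Fin n → Finset E → ℝ) (hqK : ∀ i, q i ∈ Ki S i)
    (hqmin : ∀ z : Fin n → Finset E → ℝ, (∀ i, z i ∈ Ki S i) →
      potential S c q ≤ potential S c z)
    (η : ℝ) (hη : 0 < η)
    (eta : Fin n → ℝ) (heta1 : ∀ i, η ≤ eta i) (heta2 : ∀ i, eta i ≤ 1 / lam)
    (x : ℕ → Fin n → Finset E → ℝ)
    (hx0 : ∀ i s, x 0 i s = if s ∈ S i then 1 / ((n : ℝ) * (S i).card) else 0)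
    (hupdate : ∀ t i, x (t + 1) i ∈ Ki S i ∧ ∀ z ∈ Ki S i,
      eta i * ∑ s ∈ S i, pathCost S c (x t) s * x (t + 1) i s
          + ∑ s ∈ S i, x (t + 1) i s * Real.log (x (t + 1) i s / x t i s)
        ≤ eta i * ∑ s ∈ S i, pathCost S c (x t) s * z s
          + ∑ s ∈ S i, z s * Real.log (z s / x t i s)) :
    ∀ ε ∈ Set.Ioo (0:ℝ) 1, ∀ t : ℕ,
      (n : ℝ) * Real.log ((d : ℝ) * n) / (η * ε) ≤ t →
      potential S c (x t) ≤ potential S c q + ε := by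
  intro ε hε t ht
  have hn' : (0:ℝ) < n := by positivity
  have hcpos : ∀ i, (0:ℝ) < (S i).card := fun i => by exact_mod_cast (hSne i).card_pos
  have hx0K : ∀ i, x 0 i ∈ Ki S i := by
    intro i
    have hc := hcpos i
    refine ⟨fun s => ?_, fun s hs => ?_, ?_⟩
    · rw [hx0]; split_ifs <;> positivity
    · rw [hx0, if_neg hs]
    · rw [Finset.sum_congr rfl fun s hs => by rw [hx0, if_pos hs]]
      rw [Finset.sum_const, nsmul_eq_mul]
      field_simp
  have hxK : ∀ t i, x t i ∈ Ki S i := by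
    intro t
    cases t with
    | zero => exact hx0K
    | succ t => exact fun i => (hupdate t i).1
  have heta : ∀ i, 0 < eta i := fun i => hη.trans_le (heta1 i)
  have hthree : ∀ t i, (∀ s ∈ S i, 0 < x t i s) → _ := fun t i hp =>
    cmu_three (S i) (hSne i) (x t i) (x (t+1) i) (fun s => eta i * pathCost S c (x t) s)
      (1 / (n:ℝ)) (by positivity) hp (fun s _ => (hxK (t+1) i).1 s) (hxK (t+1) i).2.2
      (fun z hz0 hz1 hz2 => by
        have := (hupdate t i).2 z ⟨hz0, hz1, hz2⟩
        simpa only [mul_assoc, Finset.mul_sum] using this)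
  have hpos : ∀ t i, ∀ s ∈ S i, 0 < x t i s := by
    intro t i
    induction t with
    | zero => intro s hs; rw [hx0, if_pos hs]; have := hcpos i; positivity
    | succ t ih => exact (hthree t i ih).1
  -- weighted divergence
  set KL : (Fin n → Finset E → ℝ) → (Fin n → Finset E → ℝ) → Fin n → ℝ :=
    fun z y i => ∑ s ∈ S i, z i s * Real.log (z i s / y i s) with hKL
  have hKLnn : ∀ z t i, (z i ∈ Ki S i) → 0 ≤ KL z (x t) i := fun z t i hz =>
    (Finset.sum_nonneg fun _ _ => sq_nonneg _).trans
      (cmu_hell (S i) (z i) (x t i) (1 / (n:ℝ)) (fun s _ => hz.1 s) (hpos t i) hz.2.2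
        (hxK t i).2.2)
  have hKLself : ∀ t i, KL (x t) (x t) i = 0 := fun t i =>
    Finset.sum_eq_zero fun s hs => by rw [div_self (hpos t i s hs).ne']; simp
  have hstep : ∀ t (z : Fin n → Finset E → ℝ), (∀ i, z i ∈ Ki S i) →
      potential S c (x (t+1)) ≤ potential S c (x t)
        + ((∑ i, ∑ s ∈ S i, pathCost S c (x t) s * z i s)
          - (∑ i, ∑ s ∈ S i, pathCost S c (x t) s * x t i s))
        + (∑ i, KL z (x t) i / eta i - ∑ i, KL z (x (t+1)) i / eta i) := by
    intro t z hz
    have h1 := (cmu_phi S hn c c' b hderiv hc'bound (x t) (x (t+1)) (hxK t) (hxK (t+1))).2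
    have h2 := cmu_loadsq S hn (x t) (x (t+1)) (hxK t) (hpos t) (hxK (t+1))
    have h3 := mul_le_mul_of_nonneg_left h2 hb.le
    have h4 : b * ((Fintype.card E : ℝ) * ∑ i, KL (x (t+1)) (x t) i)
        ≤ ∑ i, KL (x (t+1)) (x t) i / eta i := by
      rw [← mul_assoc, Finset.mul_sum]
      refine Finset.sum_le_sum fun i _ => ?_
      rw [div_eq_mul_inv, mul_comm]
      refine mul_le_mul_of_nonneg_left ?_ (hKLnn _ t i (hxK (t+1) i))
      have hk1 : (1:ℝ) ≤ k := by exact_mod_cast hk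
      have hbm : b * (Fintype.card E : ℝ) ≤ lam := by
        rw [hlam]; exact le_mul_of_one_le_right (by positivity) hk1
      have hl : 0 < lam := one_div_pos.1 ((heta i).trans_le (heta2 i))
      refine hbm.trans ?_
      rw [← one_div, le_one_div hl (heta i)]
      exact heta2 i
    have h5 : ∀ i, ∑ s ∈ S i, pathCost S c (x t) s * x (t+1) i s + KL (x (t+1)) (x t) i / eta i
        + KL z (x (t+1)) i / eta i
        ≤ ∑ s ∈ S i, pathCost S c (x t) s * z i s + KL z (x t) i / eta i := by
      intro i
      have h6 := (hthree t i (hpos t i)).2 (z i) (fun s _ => (hz i).1 s) (hz i).2.2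
      simp only [mul_assoc, ← Finset.mul_sum] at h6
      have he := heta i
      have h7 := div_le_div_of_nonneg_right h6 he.le
      rw [add_div, add_div, add_div, mul_div_cancel_left₀ _ he.ne',
        mul_div_cancel_left₀ _ he.ne'] at h7
      exact h7
    have h8 := Finset.sum_le_sum fun i (_ : i ∈ Finset.univ) => h5 i
    simp only [Finset.sum_add_distrib] at h8
    linarith
  have hmono : ∀ t, potential S c (x (t+1)) ≤ potential S c (x t) := by
    intro t
    have h := hstep t (x t) (hxK t)
    have h1 : ∑ i, KL (x t) (x t) i / eta i = 0 :=
      Finset.sum_eq_zero fun i _ => by rw [hKLself]; simp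
    have h2 : 0 ≤ ∑ i, KL (x t) (x (t+1)) i / eta i :=
      Finset.sum_nonneg fun i _ => div_nonneg (hKLnn _ _ _ (hxK t i)) (heta i).le
    linarith
  have hq1 : ∀ t, potential S c (x (t+1)) - potential S c q
      ≤ ∑ i, KL q (x t) i / eta i - ∑ i, KL q (x (t+1)) i / eta i := by
    intro t
    have h := hstep t q hqK
    have h1 := (cmu_phi S hn c c' b hderiv hc'bound (x t) q (hxK t) hqK).1
    linarith
  have hsum : ∀ t : ℕ, (t:ℝ) * (potential S c (x t) - potential S c q)
      ≤ ∑ i, KL q (x 0) i / eta i - ∑ i, KL q (x t) i / eta i := by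
    intro t
    induction t with
    | zero => simp
    | succ t ih =>
      have h1 := mul_le_mul_of_nonneg_left (hmono t) (Nat.cast_nonneg (α := ℝ) t)
      have h2 := hq1 t
      push_cast
      linarith
  have hcd : ∀ i, ((S i).card : ℝ) ≤ (d:ℝ) * n := by
    intro i
    have h1 : (S i).card ≤ d := by
      rw [hd]; exact Finset.single_le_sum (f := fun i => (S i).card) (fun _ _ => Nat.zero_le _)
        (Finset.mem_univ i)
    exact_mod_cast h1.trans (Nat.le_mul_of_pos_right d hn)
  have hlog : ∀ i, Real.log ((S i).card) ≤ Real.log ((d:ℝ) * n) := fun i =>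
    Real.log_le_log (hcpos i) (hcd i)
  have hL : 0 ≤ Real.log ((d:ℝ) * n) :=
    (Real.log_nonneg (by exact_mod_cast (hSne ⟨0, hn⟩).card_pos)).trans (hlog ⟨0, hn⟩)
  have hkl0 : ∀ i, KL q (x 0) i ≤ 1 / (n:ℝ) * Real.log ((d:ℝ) * n) := fun i =>
    (cmu_kl0 S hn hSne i (x 0 i) (q i) (hx0 i) (hqK i)).trans
      (mul_le_mul_of_nonneg_left (hlog i) (by positivity))
  have ht' : (n : ℝ) * Real.log ((d : ℝ) * n) / η ≤ t * ε := by
    have := mul_le_mul_of_nonneg_right ht hε.1.le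
    refine le_trans (le_of_eq ?_) this
    have := hε.1.ne'
    field_simp
  rcases Nat.eq_zero_or_pos t with h0 | h0
  · subst h0
    have hL0 : Real.log ((d:ℝ) * n) ≤ 0 := by
      rw [div_le_iff₀ hη] at ht'
      simp only [Nat.cast_zero, zero_mul] at ht'
      exact nonpos_of_mul_nonpos_right ht' hn'
    have hL1 := le_antisymm hL0 hL
    have heq : q = x 0 := by
      funext i s
      by_cases hs : s ∈ S i
      · refine cmu_eq (S i) (q i) (x 0 i) (1 / (n:ℝ)) (fun s _ => (hqK i).1 s) (hpos 0 i)
          (hqK i).2.2 (hxK 0 i).2.2 ?_ s hs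
        have := hkl0 i
        rw [hL1, mul_zero] at this
        exact this
      · rw [(hqK i).2.1 s hs, (hxK 0 i).2.1 s hs]
    rw [heq]
    linarith [hε.1]
  · have ht0 : (0:ℝ) < t := by exact_mod_cast h0
    have h1 : ∑ i, KL q (x 0) i / eta i ≤ Real.log ((d:ℝ) * n) / η := by
      calc _ ≤ ∑ i : Fin n, (1 / (n:ℝ) * Real.log ((d:ℝ) * n)) / η := by
            refine Finset.sum_le_sum fun i _ => ?_
            exact div_le_div₀ (by positivity) (hkl0 i) hη (heta1 i)
        _ = _ := by
            rw [Finset.sum_const, Finset.card_univ, Fintype.card_fin, nsmul_eq_mul]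
            field_simp
    have h2 : 0 ≤ ∑ i, KL q (x t) i / eta i :=
      Finset.sum_nonneg fun i _ => div_nonneg (hKLnn _ _ _ (hqK i)) (heta i).le
    have h3 : Real.log ((d:ℝ) * n) / η ≤ (n : ℝ) * Real.log ((d : ℝ) * n) / η := by
      have hn1 : (1:ℝ) ≤ n := by exact_mod_cast hn
      exact div_le_div_of_nonneg_right (le_mul_of_one_le_left hL hn1) hη.le
    have h4 := hsum t
    have h5 : (t:ℝ) * (potential S c (x t) - potential S c q) ≤ t * ε := by linarith
    have := le_of_mul_le_mul_left h5 ht0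
    linarith
end

section
/- Expected path cost under random atomic choices versus the mixed-strategy cost: in an atomic congestion game of n players, suppose each edge cost function c_e is twice continuously differentiable on [0,1] with 0 ≤ c_e''(y) ≤ B for all y ∈ [0,1]. Let x ∈ 𝒦 be a joint mixed-strategy profile, and let X be the random choice vector in which, independently for each player i, exactly one coordinate X_{i,s} equals 1/n — path s being selected with probability n·x_{i,s} — and all other coordinates of X_i are 0. Then for every path s, 0 ≤ E[c_s(X)] − c_s(x) ≤ Bm/(8n). In particular, if every c_e is linear (B = 0), then E[c_s(X)] = c_s(x). -/
open Finset

/-- The load on edge `e` when each player `j` routes her whole flow `1/n` on the single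
path `σ j`. -/
noncomputable def loadChoice {n : ℕ} {E : Type*} [DecidableEq E]
    (σ : Fin n → Finset E) (e : E) : ℝ :=
  ∑ j, if e ∈ σ j then (1:ℝ) / n else 0

/-- The expected cost of path `s` when, independently, each player `i` chooses path
`r ∈ 𝒮_i` with probability `n·x_{i,r}` and routes her flow `1/n` on it:
`E[c_s(X)] = Σ_σ (Π_i n·x_{i,σ(i)}) · Σ_{e∈s} c_e(ℓ_e(X_σ))`. -/
noncomputable def expPathCost {n : ℕ} {E : Type*} [Fintype E] [DecidableEq E]
    (S : Fin n → Finset (Finset E)) (c : E → ℝ → ℝ)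
    (x : Fin n → Finset E → ℝ) (s : Finset E) : ℝ :=
  ∑ σ ∈ Fintype.piFinset S, (∏ i, (n : ℝ) * x i (σ i)) * ∑ e ∈ s, c e (loadChoice σ e)


theorem tangent_aux (f f' f'' : ℝ → ℝ)
    (h1 : ∀ y ∈ Set.Icc (0:ℝ) 1, HasDerivWithinAt f (f' y) (Set.Icc 0 1) y)
    (h2 : ∀ y ∈ Set.Icc (0:ℝ) 1, HasDerivWithinAt f' (f'' y) (Set.Icc 0 1) y)
    (h3 : ∀ y ∈ Set.Icc (0:ℝ) 1, 0 ≤ f'' y)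
    (p y : ℝ) (hp : p ∈ Set.Icc (0:ℝ) 1) (hy : y ∈ Set.Icc (0:ℝ) 1) :
    f p + f' p * (y - p) ≤ f y := by
  have hmono : MonotoneOn f' (Set.Icc 0 1) := by
    refine monotoneOn_of_hasDerivWithinAt_nonneg (f' := f'') (convex_Icc 0 1)
      (fun y hy => (h2 y hy).continuousWithinAt) ?_ ?_
    · intro z hz
      exact (h2 z (interior_subset hz)).mono interior_subset
    · intro z hz
      exact h3 z (interior_subset hz)
  have key : ∀ a b : ℝ, 0 ≤ a → b ≤ 1 → a < b →
      ∃ ξ ∈ Set.Ioo a b, f b - f a = f' ξ * (b - a) := by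
    intro a b ha hb hab
    have hsub : Set.Icc a b ⊆ Set.Icc 0 1 := Set.Icc_subset_Icc ha hb
    obtain ⟨ξ, hξ, h⟩ := exists_hasDerivAt_eq_slope f f' hab
      (fun z hz => ((h1 z (hsub hz)).mono hsub).continuousWithinAt)
      (fun z hz => (h1 z (hsub ⟨hz.1.le, hz.2.le⟩)).hasDerivAt
        (Icc_mem_nhds (ha.trans_lt hz.1) (hz.2.trans_le hb)))
    refine ⟨ξ, hξ, ?_⟩
    rw [h]
    have : b - a ≠ 0 := by linarith
    field_simp
  rcases lt_trichotomy p y with h | h | h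
  · obtain ⟨ξ, hξ, e⟩ := key p y hp.1 hy.2 h
    have := hmono hp ⟨hp.1.trans hξ.1.le, hξ.2.le.trans hy.2⟩ hξ.1.le
    nlinarith
  · subst h; simp
  · obtain ⟨ξ, hξ, e⟩ := key y p hy.1 hp.2 h
    have := hmono ⟨hy.1.trans hξ.1.le, hξ.2.le.trans hp.2⟩ hp hξ.2.le
    nlinarith

theorem taylor_upper (f f' f'' : ℝ → ℝ) (B : ℝ)
    (h1 : ∀ y ∈ Set.Icc (0:ℝ) 1, HasDerivWithinAt f (f' y) (Set.Icc 0 1) y)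
    (h2 : ∀ y ∈ Set.Icc (0:ℝ) 1, HasDerivWithinAt f' (f'' y) (Set.Icc 0 1) y)
    (h3 : ∀ y ∈ Set.Icc (0:ℝ) 1, f'' y ≤ B)
    (p y : ℝ) (hp : p ∈ Set.Icc (0:ℝ) 1) (hy : y ∈ Set.Icc (0:ℝ) 1) :
    f y ≤ f p + f' p * (y - p) + B / 2 * (y - p) ^ 2 := by
  have := tangent_aux (fun y => B / 2 * y ^ 2 - f y) (fun y => B * y - f' y)
    (fun y => B - f'' y) ?_ ?_ ?_ p y hp hy
  · nlinarith
  · intro y hy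
    have h := (((hasDerivAt_id y).pow 2).const_mul (B / 2)).hasDerivWithinAt (s := Set.Icc 0 1)
    have h' := h.sub (h1 y hy)
    refine h'.congr_deriv ?_
    simp
    ring
  · intro y hy
    have h := ((hasDerivAt_id y).const_mul B).hasDerivWithinAt (s := Set.Icc 0 1)
    have h' := h.sub (h2 y hy)
    refine h'.congr_deriv ?_
    simp
  · intro y hy
    have := h3 y hy
    linarith

section moments
variable {n : ℕ} {A : Type*} [DecidableEq A] (S : Fin n → Finset A) (p : Fin n → A → ℝ)

theorem exp_prod (f : Fin n → A → ℝ) :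
    ∑ σ ∈ Fintype.piFinset S, (∏ i, p i (σ i)) * ∏ i, f i (σ i)
      = ∏ i, ∑ a ∈ S i, p i a * f i a := by
  rw [Finset.prod_univ_sum]
  simp only [Finset.prod_mul_distrib]

theorem exp_one (hp : ∀ i, ∑ a ∈ S i, p i a = 1) :
    ∑ σ ∈ Fintype.piFinset S, (∏ i, p i (σ i)) = 1 := by
  have := exp_prod S p (fun _ _ => 1)
  simpa [hp] using this

theorem exp_single (hp : ∀ i, ∑ a ∈ S i, p i a = 1) (j : Fin n) (g : A → ℝ) :
    ∑ σ ∈ Fintype.piFinset S, (∏ i, p i (σ i)) * g (σ j) = ∑ a ∈ S j, p j a * g a := by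
  have := exp_prod S p (fun i a => if i = j then g a else 1)
  simp only [Finset.prod_ite_eq', Finset.mem_univ, if_true] at this
  rw [this, Finset.prod_eq_single j]
  · simp
  · intro i _ hij
    simp [hij, hp]
  · simp

theorem exp_pair (j k : Fin n) (hjk : j ≠ k) (g h : A → ℝ)
    (hg : ∑ a ∈ S j, p j a * g a = 0) :
    ∑ σ ∈ Fintype.piFinset S, (∏ i, p i (σ i)) * (g (σ j) * h (σ k)) = 0 := by
  have := exp_prod S p (fun i a => (if i = j then g a else 1) * (if i = k then h a else 1))
  simp only [Finset.prod_mul_distrib, Finset.prod_ite_eq', Finset.mem_univ, if_true] at this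
  rw [this]
  apply Finset.prod_eq_zero (Finset.mem_univ j)
  simpa [hjk] using hg

theorem exp_sum (hp : ∀ i, ∑ a ∈ S i, p i a = 1) (g : Fin n → A → ℝ)
    (hg : ∀ j, ∑ a ∈ S j, p j a * g j a = 0) :
    ∑ σ ∈ Fintype.piFinset S, (∏ i, p i (σ i)) * ∑ j, g j (σ j) = 0 := by
  simp only [Finset.mul_sum]
  rw [Finset.sum_comm]
  apply Finset.sum_eq_zero
  intro j _
  rw [exp_single S p hp j (g j), hg]

theorem exp_sq (hp : ∀ i, ∑ a ∈ S i, p i a = 1) (g : Fin n → A → ℝ)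
    (hg : ∀ j, ∑ a ∈ S j, p j a * g j a = 0) :
    ∑ σ ∈ Fintype.piFinset S, (∏ i, p i (σ i)) * (∑ j, g j (σ j)) ^ 2
      = ∑ j, ∑ a ∈ S j, p j a * (g j a) ^ 2 := by
  simp only [sq, Finset.sum_mul_sum]
  simp only [Finset.mul_sum]
  rw [Finset.sum_comm]
  refine Finset.sum_congr rfl fun j _ => ?_
  rw [Finset.sum_comm, Finset.sum_eq_single j]
  · exact exp_single S p hp j (fun a => g j a * g j a)
  · intro k _ hk
    exact exp_pair S p j k (Ne.symm hk) (g j) (g k) (hg j)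
  · simp

end moments

theorem edge_bound_s16 {n : ℕ} (hn : 0 < n) {E : Type*} [Fintype E] [DecidableEq E]
    (S : Fin n → Finset (Finset E))
    (f f' f'' : ℝ → ℝ) (B : ℝ) (hB : 0 ≤ B)
    (h1 : ∀ y ∈ Set.Icc (0:ℝ) 1, HasDerivWithinAt f (f' y) (Set.Icc 0 1) y)
    (h2 : ∀ y ∈ Set.Icc (0:ℝ) 1, HasDerivWithinAt f' (f'' y) (Set.Icc 0 1) y)
    (h3 : ∀ y ∈ Set.Icc (0:ℝ) 1, 0 ≤ f'' y ∧ f'' y ≤ B)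
    (x : Fin n → Finset E → ℝ)
    (hx1 : ∀ i s, 0 ≤ x i s)
    (hx3 : ∀ i, ∑ s ∈ S i, x i s = 1 / (n:ℝ)) (e : E) :
    f (load S x e) ≤ ∑ σ ∈ Fintype.piFinset S,
      (∏ i, (n : ℝ) * x i (σ i)) * f (loadChoice σ e) ∧
    ∑ σ ∈ Fintype.piFinset S,
      (∏ i, (n : ℝ) * x i (σ i)) * f (loadChoice σ e) ≤ f (load S x e) + B / (8 * n) := by
  have hn' : (0:ℝ) < n := by exact_mod_cast hn
  set p : Fin n → Finset E → ℝ := fun i a => (n:ℝ) * x i a with hpdef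
  have hp : ∀ i, ∑ a ∈ S i, p i a = 1 := by
    intro i
    simp only [hpdef]
    rw [← Finset.mul_sum, hx3]
    field_simp
  set q : Fin n → ℝ := fun i => ∑ s ∈ (S i).filter (fun s => e ∈ s), x i s with hq
  have hq0 : ∀ i, 0 ≤ q i := fun i => Finset.sum_nonneg fun a _ => hx1 i a
  have hq1 : ∀ i, q i ≤ 1 / n := fun i => by
    rw [← hx3 i]
    exact Finset.sum_le_sum_of_subset_of_nonneg (Finset.filter_subset _ _) fun a _ _ => hx1 i a
  have hload : load S x e = ∑ i, q i := rfl
  have hcard : ∑ _i : Fin n, (1:ℝ) / n = 1 := by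
    simp
    field_simp
  have hl : load S x e ∈ Set.Icc (0:ℝ) 1 := by
    rw [hload]
    refine ⟨Finset.sum_nonneg fun i _ => hq0 i, ?_⟩
    rw [← hcard]
    exact Finset.sum_le_sum fun i _ => hq1 i
  have hlc : ∀ σ : Fin n → Finset E, loadChoice σ e ∈ Set.Icc (0:ℝ) 1 := by
    intro σ
    unfold loadChoice
    refine ⟨Finset.sum_nonneg fun i _ => by split_ifs <;> positivity, ?_⟩
    refine le_trans ?_ hcard.le
    refine Finset.sum_le_sum fun i _ => ?_
    have : (0:ℝ) ≤ 1 / n := by positivity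
    split_ifs <;> linarith
  set g : Fin n → Finset E → ℝ := fun j a => (if e ∈ a then (1:ℝ) / n else 0) - q j with hgdef
  have hd : ∀ σ : Fin n → Finset E, loadChoice σ e - load S x e = ∑ j, g j (σ j) := by
    intro σ
    rw [hload, loadChoice, ← Finset.sum_sub_distrib]
  have hA : ∀ j, ∑ a ∈ S j, p j a * (if e ∈ a then (1:ℝ) / n else 0) = q j := by
    intro j
    simp only [hq, Finset.sum_filter]
    refine Finset.sum_congr rfl fun a _ => ?_
    simp only [hpdef]
    split_ifs
    · field_simp
    · simp
  have hg : ∀ j, ∑ a ∈ S j, p j a * g j a = 0 := by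
    intro j
    simp only [hgdef, mul_sub, Finset.sum_sub_distrib, hA]
    rw [← Finset.sum_mul, hp]
    ring
  have hv : ∀ j, ∑ a ∈ S j, p j a * (g j a) ^ 2 ≤ 1 / (4 * n ^ 2) := by
    intro j
    have : ∀ a, p j a * (g j a) ^ 2 =
        (1 / n - 2 * q j) * (p j a * (if e ∈ a then (1:ℝ) / n else 0)) + p j a * (q j) ^ 2 := by
      intro a
      simp only [hgdef]
      split_ifs <;> ring
    simp only [this, Finset.sum_add_distrib]
    rw [← Finset.mul_sum, hA, ← Finset.sum_mul, hp]
    have h4 : 1 / (4 * (n:ℝ) ^ 2) = (1 / n) ^ 2 / 4 := by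
      field_simp
    rw [h4]
    nlinarith [sq_nonneg (1 / (n:ℝ) - 2 * q j)]
  have hw : ∀ σ : Fin n → Finset E, 0 ≤ ∏ i, p i (σ i) := fun σ =>
    Finset.prod_nonneg fun i _ => mul_nonneg hn'.le (hx1 _ _)
  have e1 := exp_one S p hp
  have e2 := exp_sum S p hp g hg
  have e3 := exp_sq S p hp g hg
  have e4 : ∑ j, ∑ a ∈ S j, p j a * (g j a) ^ 2 ≤ 1 / (4 * n) := by
    refine (Finset.sum_le_sum fun j _ => hv j).trans (le_of_eq ?_)
    simp
    field_simp
  rw [← e3] at e4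
  simp only [← hd] at e2 e4
  constructor
  · calc f (load S x e) = ∑ σ ∈ Fintype.piFinset S, (∏ i, p i (σ i)) *
          (f (load S x e) + f' (load S x e) * (loadChoice σ e - load S x e)) := by
          have : ∀ σ : Fin n → Finset E, (∏ i, p i (σ i)) *
              (f (load S x e) + f' (load S x e) * (loadChoice σ e - load S x e)) =
              (∏ i, p i (σ i)) * f (load S x e) + f' (load S x e) *
              ((∏ i, p i (σ i)) * (loadChoice σ e - load S x e)) := fun σ => by ring
          simp only [this, Finset.sum_add_distrib]
          rw [← Finset.mul_sum, ← Finset.sum_mul, e1, e2]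
          ring
      _ ≤ _ := Finset.sum_le_sum fun σ _ => mul_le_mul_of_nonneg_left
          (tangent_aux f f' f'' h1 h2 (fun y hy => (h3 y hy).1) _ _ hl (hlc σ)) (hw σ)
  · calc _ ≤ ∑ σ ∈ Fintype.piFinset S, (∏ i, p i (σ i)) *
          (f (load S x e) + f' (load S x e) * (loadChoice σ e - load S x e)
            + B / 2 * (loadChoice σ e - load S x e) ^ 2) :=
          Finset.sum_le_sum fun σ _ => mul_le_mul_of_nonneg_left
          (taylor_upper f f' f'' B h1 h2 (fun y hy => (h3 y hy).2) _ _ hl (hlc σ)) (hw σ)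
      _ = f (load S x e) + B / 2 * ∑ σ ∈ Fintype.piFinset S, (∏ i, p i (σ i)) *
            (loadChoice σ e - load S x e) ^ 2 := by
          have : ∀ σ : Fin n → Finset E, (∏ i, p i (σ i)) *
              (f (load S x e) + f' (load S x e) * (loadChoice σ e - load S x e)
                + B / 2 * (loadChoice σ e - load S x e) ^ 2) =
              (∏ i, p i (σ i)) * f (load S x e) + f' (load S x e) *
              ((∏ i, p i (σ i)) * (loadChoice σ e - load S x e)) +
              B / 2 * ((∏ i, p i (σ i)) * (loadChoice σ e - load S x e) ^ 2) := fun σ => by ring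
          simp only [this, Finset.sum_add_distrib]
          rw [← Finset.mul_sum, ← Finset.mul_sum, ← Finset.sum_mul, e1, e2]
          ring
      _ ≤ f (load S x e) + B / 2 * (1 / (4 * n)) := by gcongr
      _ = _ := by
          field_simp
          ring

/-- expected path cost under random atomic choices versus the
mixed-strategy cost.  If each `c_e` is twice continuously differentiable on `[0,1]` with
`0 ≤ c_e'' ≤ B`, then for every path `s` (of at most `m` edges, as all paths are),
`0 ≤ E[c_s(X)] − c_s(x) ≤ Bm/(8n)`. -/
theorem expected_cost_vs_mixed_cost
    {n : ℕ} (hn : 0 < n) {E : Type*} [Fintype E] [DecidableEq E]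
    (S : Fin n → Finset (Finset E))
    (hSne : ∀ i, (S i).Nonempty)
    (hpaths : ∀ i, ∀ s ∈ S i, s.Nonempty)
    (m : ℕ) (hm : ∀ i, ∀ s ∈ S i, s.card ≤ m)
    (c c' c'' : E → ℝ → ℝ) (B : ℝ) (hB : 0 ≤ B)
    (hderiv : ∀ e, ∀ y ∈ Set.Icc (0:ℝ) 1, HasDerivWithinAt (c e) (c' e y) (Set.Icc 0 1) y)
    (hderiv2 : ∀ e, ∀ y ∈ Set.Icc (0:ℝ) 1,
      HasDerivWithinAt (c' e) (c'' e y) (Set.Icc 0 1) y)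
    (hc''cont : ∀ e, ContinuousOn (c'' e) (Set.Icc 0 1))
    (hc''bound : ∀ e, ∀ y ∈ Set.Icc (0:ℝ) 1, 0 ≤ c'' e y ∧ c'' e y ≤ B)
    (x : Fin n → Finset E → ℝ)
    (hx1 : ∀ i s, 0 ≤ x i s) (hx2 : ∀ i, ∀ s ∉ S i, x i s = 0)
    (hx3 : ∀ i, ∑ s ∈ S i, x i s = 1 / (n:ℝ))
    (i₀ : Fin n) (s : Finset E) (hs : s ∈ S i₀) :
    0 ≤ expPathCost S c x s - pathCost S c x s ∧
    expPathCost S c x s - pathCost S c x s ≤ B * m / (8 * n) := by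
  have hn' : (0:ℝ) < n := by exact_mod_cast hn
  have hexp : expPathCost S c x s = ∑ e ∈ s, ∑ σ ∈ Fintype.piFinset S,
      (∏ i, (n : ℝ) * x i (σ i)) * c e (loadChoice σ e) := by
    unfold expPathCost
    simp only [Finset.mul_sum]
    rw [Finset.sum_comm]
  have hb := fun e => edge_bound_s16 hn S (c e) (c' e) (c'' e) B hB (hderiv e) (hderiv2 e)
    (hc''bound e) x hx1 hx3 e
  rw [hexp, pathCost, ← Finset.sum_sub_distrib]
  refine ⟨Finset.sum_nonneg fun e _ => sub_nonneg.2 (hb e).1, ?_⟩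
  calc _ ≤ ∑ _e ∈ s, B / (8 * n) := Finset.sum_le_sum fun e _ => by linarith [(hb e).2]
    _ = s.card * (B / (8 * n)) := by simp
    _ ≤ m * (B / (8 * n)) := by
        have : (s.card : ℝ) ≤ m := by exact_mod_cast hm i₀ s hs
        gcongr
    _ = _ := by ring
end

section
/- Two-sided comparison between the squared Euclidean distance and the Kullback–Leibler Bregman divergence on the truncated simplex: fix n ≥ 1 and Λ ∈ (0,1], and let 𝒦̄_i be the set of vectors x = (x_s)_{s∈S} indexed by a finite set S with x_s ≥ Λ/n for all s and Σ_{s∈S} x_s = 1/n. Define B(x,y) = Σ_{s∈S} x_s ln(x_s / y_s) for x, y ∈ 𝒦̄_i. Then for all x, y ∈ 𝒦̄_i, (Λ/n) · B(x,y) ≤ ‖x − y‖₂² and ‖x − y‖₂² ≤ 2 · B(x,y). -/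
open Finset

lemma kl_deriv_aux (y x : ℝ) (hx : 0 < x) :
    HasDerivAt (fun x => x * (Real.log x - Real.log y) - x + y - (x - y) ^ 2 / 2)
      (Real.log x - Real.log y - (x - y)) x := by
  have h1 := (Real.hasDerivAt_log hx.ne').sub_const (Real.log y)
  have h2 := (((hasDerivAt_id x).mul h1).sub (hasDerivAt_id x)).add_const y
  have h3 := (((hasDerivAt_id x).sub_const y).pow 2).div_const 2
  have h4 := h2.sub h3
  refine h4.congr_deriv ?_
  simp only [id]
  field_simp
  ring

lemma kl_pt (x y : ℝ) (hx : 0 < x) (hy : 0 < y) (hx1 : x ≤ 1) (hy1 : y ≤ 1) :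
    (x - y) ^ 2 / 2 ≤ x * Real.log (x / y) - x + y := by
  rw [Real.log_div hx.ne' hy.ne']
  have key : ∀ a b : ℝ, 0 < a → a ≤ b → b ≤ 1 → b - a ≤ Real.log b - Real.log a := by
    intro a b ha hab hb
    have hb0 : 0 < b := ha.trans_le hab
    have h := Real.log_le_sub_one_of_pos (div_pos ha hb0)
    rw [Real.log_div ha.ne' hb0.ne'] at h
    have : a / b ≤ 1 - (b - a) := by
      rw [div_le_iff₀ hb0]; nlinarith
    linarith
  let f : ℝ → ℝ := fun x => x * (Real.log x - Real.log y) - x + y - (x - y) ^ 2 / 2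
  have hfy : f y = 0 := by simp [f]
  suffices h : f y ≤ f x by
    rw [hfy] at h; simp only [f] at h; linarith
  rcases le_total x y with hxy | hxy
  · have : AntitoneOn f (Set.Icc x y) := by
      apply antitoneOn_of_deriv_nonpos (convex_Icc x y)
      · intro z hz
        exact (kl_deriv_aux y z (hx.trans_le hz.1)).continuousAt.continuousWithinAt
      · intro z hz
        rw [interior_Icc] at hz
        exact (kl_deriv_aux y z (hx.trans hz.1)).differentiableAt.differentiableWithinAt
      · intro z hz
        rw [interior_Icc] at hz
        rw [(kl_deriv_aux y z (hx.trans hz.1)).deriv]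
        linarith [key z y (hx.trans hz.1) hz.2.le hy1]
    exact this ⟨le_rfl, hxy⟩ ⟨hxy, le_rfl⟩ hxy
  · have : MonotoneOn f (Set.Icc y x) := by
      apply monotoneOn_of_deriv_nonneg (convex_Icc y x)
      · intro z hz
        exact (kl_deriv_aux y z (hy.trans_le hz.1)).continuousAt.continuousWithinAt
      · intro z hz
        rw [interior_Icc] at hz
        exact (kl_deriv_aux y z (hy.trans hz.1)).differentiableAt.differentiableWithinAt
      · intro z hz
        rw [interior_Icc] at hz
        rw [(kl_deriv_aux y z (hy.trans hz.1)).deriv]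
        linarith [key y z hy hz.1.le (hz.2.le.trans hx1)]
    exact this ⟨le_rfl, hxy⟩ ⟨hxy, le_rfl⟩ hxy

/-- two-sided comparison between the squared Euclidean distance and the
Kullback–Leibler Bregman divergence `B(x,y) = Σ_s x_s ln(x_s/y_s)` on the truncated
simplex `{x : x_s ≥ Λ/n, Σ_s x_s = 1/n}`:
`(Λ/n)·B(x,y) ≤ ‖x − y‖₂²` and `‖x − y‖₂² ≤ 2·B(x,y)`. -/
theorem kl_euclidean_comparison
    {S : Type*} [Fintype S]
    (n : ℕ) (hn : 1 ≤ n) (Λ : ℝ) (hΛ : Λ ∈ Set.Ioc (0:ℝ) 1)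
    (x y : S → ℝ)
    (hx1 : ∀ s, Λ / n ≤ x s) (hx2 : ∑ s, x s = 1 / (n:ℝ))
    (hy1 : ∀ s, Λ / n ≤ y s) (hy2 : ∑ s, y s = 1 / (n:ℝ)) :
    Λ / n * ∑ s, x s * Real.log (x s / y s) ≤ ∑ s, (x s - y s) ^ 2 ∧
    ∑ s, (x s - y s) ^ 2 ≤ 2 * ∑ s, x s * Real.log (x s / y s) := by
  have hn0 : (0:ℝ) < n := by exact_mod_cast hn
  have hn1 : 1 / (n:ℝ) ≤ 1 := by
    rw [div_le_one hn0]; exact_mod_cast hn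
  have hc : 0 < Λ / n := div_pos hΛ.1 hn0
  have hx0 : ∀ s, 0 < x s := fun s => hc.trans_le (hx1 s)
  have hy0 : ∀ s, 0 < y s := fun s => hc.trans_le (hy1 s)
  have hxl : ∀ s, x s ≤ 1 := fun s =>
    (Finset.single_le_sum (fun i _ => (hx0 i).le) (Finset.mem_univ s)).trans (hx2.le.trans hn1)
  have hyl : ∀ s, y s ≤ 1 := fun s =>
    (Finset.single_le_sum (fun i _ => (hy0 i).le) (Finset.mem_univ s)).trans (hy2.le.trans hn1)
  have hB : ∑ s, x s * Real.log (x s / y s) = ∑ s, (x s * Real.log (x s / y s) - x s + y s) := by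
    rw [Finset.sum_add_distrib, Finset.sum_sub_distrib, hx2, hy2]; ring
  rw [hB, Finset.mul_sum, Finset.mul_sum]
  constructor
  · refine Finset.sum_le_sum fun s _ => ?_
    have h := Real.log_le_sub_one_of_pos (div_pos (hx0 s) (hy0 s))
    have h1 := kl_pt (x s) (y s) (hx0 s) (hy0 s) (hxl s) (hyl s)
    have h2 : 0 ≤ x s * Real.log (x s / y s) - x s + y s := le_trans (by positivity) h1
    refine (mul_le_mul_of_nonneg_right (hy1 s) h2).trans ?_
    have h3 : y s * (x s * Real.log (x s / y s)) ≤ y s * (x s * (x s / y s - 1)) :=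
      mul_le_mul_of_nonneg_left (mul_le_mul_of_nonneg_left h (hx0 s).le) (hy0 s).le
    have h4 : y s * (x s * (x s / y s - 1)) = x s * (x s - y s) := by
      have := (hy0 s).ne'
      field_simp
    nlinarith
  · refine Finset.sum_le_sum fun s _ => ?_
    linarith [kl_pt (x s) (y s) (hx0 s) (hy0 s) (hxl s) (hyl s)]
end

section
/- Convergence of generalized mirror descent with approximate gradients: let 𝒦 = 𝒦₁ × ⋯ × 𝒦_n ⊆ ℝ^D, each 𝒦_i compact convex, every coordinate of every point of 𝒦 lying in [0,1/n], and ‖x − y‖₁ ≤ 2 for all x, y ∈ 𝒦. Let Φ : 𝒦 → ℝ be convex and differentiable with 0 ≤ Φ(x) ≤ α, ‖∇Φ(x)‖_∞ ≤ β, and Φ(x') ≤ Φ(x) + ⟨∇Φ(x), x'−x⟩ + (λ/2)‖x'−x‖₂² for all x, x' ∈ 𝒦; let q minimize Φ over 𝒦. For each i let 𝒦̄_i ⊆ 𝒦_i be convex with the property that every x ∈ 𝒦 has some y ∈ 𝒦̄ = 𝒦̄₁ × ⋯ × 𝒦̄_n with ‖x − y‖₁ ≤ dΛ, and let R_i be differentiable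 strictly convex functions satisfying Γ·B^{R_i}(u,v) ≤ ‖u−v‖₂² ≤ 2·B^{R_i}(u,v) for all u, v ∈ 𝒦̄_i. Suppose x⁰ ∈ 𝒦̄ and for each episode τ, x_i^{τ+1} = argmin_{z∈𝒦̄_i} { η_i ⟨ĝ_i^τ, z⟩ + B^{R_i}(z, x_i^τ) }, where ‖ĝ_i^τ − ∇_iΦ(x^τ)‖_∞ ≤ ε̂ for every i and τ, and η ≤ η_i ≤ 1/λ. Set θ = √(ηΓε̂n), assume θ ≤ 1, and set δ = 6ε̂ + θβdΛ. Then for every τ ≥ α/δ, Φ(x^τ) ≤ Φ(q) + 3δ/θ. -/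
open Finset RealInnerProductSpace

theorem amd_inner_le {k : ℕ} (a b : EuclideanSpace ℝ (Fin k)) (c : ℝ)
    (h : ∀ j, |a j| ≤ c) : ⟪a, b⟫ ≤ c * ∑ j, |b j| := by
  rw [PiLp.inner_apply, Finset.mul_sum]
  refine Finset.sum_le_sum fun j _ => ?_
  have h1 : inner ℝ (a j) (b j) = b j * a j := by simp
  rw [h1]
  calc b j * a j ≤ |b j * a j| := le_abs_self _
    _ = |a j| * |b j| := by rw [abs_mul, mul_comm]
    _ ≤ c * |b j| := mul_le_mul_of_nonneg_right (h j) (abs_nonneg _)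

theorem amd_rec (h : ℕ → ℝ) (α θ δ : ℝ) (hα : 0 < α) (hθ : 0 < θ) (hθ1 : θ ≤ 1) (hδ : 0 < δ)
    (h0 : h 0 ≤ α) (hs : ∀ t, h (t + 1) ≤ (1 - θ) * h t + δ) (t : ℕ) (ht : α / δ ≤ t) :
    h t ≤ 3 * δ / θ := by
  have key : ∀ t, h t ≤ (1 - θ) ^ t * α + δ / θ := by
    intro t
    induction t with
    | zero => have := div_pos hδ hθ; simp; linarith
    | succ t ih =>
      have h1 := mul_le_mul_of_nonneg_left ih (sub_nonneg.2 hθ1)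
      have h2 : (1 - θ) * (δ / θ) + δ = δ / θ := by field_simp; ring
      have h3 := hs t
      rw [pow_succ]
      nlinarith
  have hb : 1 + (t : ℝ) * θ ≤ (1 + θ) ^ t := one_add_mul_le_pow (by linarith) t
  have hp : 0 ≤ (1 - θ) ^ t := pow_nonneg (sub_nonneg.2 hθ1) t
  have h1 : (1 - θ) ^ t * (1 + θ) ^ t ≤ 1 := by
    rw [← mul_pow]
    exact pow_le_one₀ (by nlinarith) (by nlinarith)
  have h2 : (1 - θ) ^ t * (t * θ) ≤ 1 := by
    have := mul_le_mul_of_nonneg_left hb hp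
    nlinarith
  have h3 : α ≤ t * δ := by rwa [div_le_iff₀ hδ] at ht
  have h4 : (1 - θ) ^ t * α ≤ δ / θ := by
    rw [le_div_iff₀ hθ]
    have := mul_le_mul_of_nonneg_left h3 (mul_nonneg hp hθ.le)
    have := mul_le_mul_of_nonneg_right h2 hδ.le
    nlinarith
  have h5 : 3 * δ / θ = δ / θ + δ / θ + δ / θ := by ring
  have := div_pos hδ hθ
  linarith [key t]

/-- convergence of generalized mirror descent with approximate gradients.
`𝒦 = 𝒦₁ × ⋯ × 𝒦_n` has all coordinates in `[0,1/n]` and ℓ₁-diameter at most `2`;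
`Φ` is convex, bounded by `α`, with gradient bounded by `β` in sup norm and Euclidean
`λ`-smoothness; the truncated sets `𝒦̄_i ⊆ 𝒦_i` approximate `𝒦` within `dΛ` in ℓ₁;
the regularizers satisfy `Γ·B ≤ ‖·‖₂² ≤ 2B` on `𝒦̄_i`; the updates use approximate
gradients `ĝ` with coordinatewise error at most `ε̂` and step sizes `η ≤ η_i ≤ 1/λ`.
With `θ = √(ηΓε̂n) ≤ 1` and `δ = 6ε̂ + θβdΛ`, one has `Φ(x^τ) ≤ Φ(q) + 3δ/θ` for every
episode `τ ≥ α/δ`. -/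
theorem approx_mirror_descent_converges
    {n : ℕ} (hn : 0 < n) (dim : Fin n → ℕ)
    (K Kbar : (i : Fin n) → Set (EuclideanSpace ℝ (Fin (dim i))))
    (hKconv : ∀ i, Convex ℝ (K i)) (hKcpt : ∀ i, IsCompact (K i))
    (hKbarsub : ∀ i, Kbar i ⊆ K i) (hKbarconv : ∀ i, Convex ℝ (Kbar i))
    (hcoord : ∀ i, ∀ u ∈ K i, ∀ j, u j ∈ Set.Icc (0:ℝ) (1 / n))
    (hdiam : ∀ u v : (i : Fin n) → EuclideanSpace ℝ (Fin (dim i)),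
      (∀ i, u i ∈ K i) → (∀ i, v i ∈ K i) → ∑ i, ∑ j, |u i j - v i j| ≤ 2)
    (Φ : ((i : Fin n) → EuclideanSpace ℝ (Fin (dim i))) → ℝ)
    (gΦ : ((i : Fin n) → EuclideanSpace ℝ (Fin (dim i))) →
          ((i : Fin n) → EuclideanSpace ℝ (Fin (dim i))))
    (α β lam d Λ Γ η εh : ℝ)
    (hα : 0 < α) (hβ : 0 < β) (hlam : 0 < lam) (hd : 0 < d) (hΛ : 0 < Λ)
    (hΓ : 0 < Γ) (hη : 0 < η) (hεh : 0 < εh)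
    (hΦrange : ∀ x, (∀ i, x i ∈ K i) → Φ x ∈ Set.Icc 0 α)
    (hgradbound : ∀ x, (∀ i, x i ∈ K i) → ∀ i j, |gΦ x i j| ≤ β)
    (hconv : ∀ x y, (∀ i, x i ∈ K i) → (∀ i, y i ∈ K i) →
      Φ x + ∑ i, ⟪gΦ x i, y i - x i⟫ ≤ Φ y)
    (hsmooth : ∀ x y, (∀ i, x i ∈ K i) → (∀ i, y i ∈ K i) →
      Φ y ≤ Φ x + ∑ i, ⟪gΦ x i, y i - x i⟫
            + lam / 2 * ∑ i, ∑ j, (y i j - x i j) ^ 2)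
    (q : (i : Fin n) → EuclideanSpace ℝ (Fin (dim i)))
    (hqK : ∀ i, q i ∈ K i) (hqmin : ∀ z, (∀ i, z i ∈ K i) → Φ q ≤ Φ z)
    (happrox : ∀ x : (i : Fin n) → EuclideanSpace ℝ (Fin (dim i)),
      (∀ i, x i ∈ K i) → ∃ y : (i : Fin n) → EuclideanSpace ℝ (Fin (dim i)),
        (∀ i, y i ∈ Kbar i) ∧
        ∑ i, ∑ j, |x i j - y i j| ≤ d * Λ)
    (R : (i : Fin n) → EuclideanSpace ℝ (Fin (dim i)) → ℝ)
    (gR : (i : Fin n) → EuclideanSpace ℝ (Fin (dim i)) → EuclideanSpace ℝ (Fin (dim i)))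
    (hRgradAt : ∀ i, ∀ v ∈ Kbar i, HasGradientAt (R i) (gR i v) v)
    (hRstrict : ∀ i, StrictConvexOn ℝ (Kbar i) (R i))
    (hΓB : ∀ i, ∀ u ∈ Kbar i, ∀ v ∈ Kbar i,
      Γ * breg (R i) (gR i) u v ≤ ∑ j, (u j - v j) ^ 2 ∧
      ∑ j, (u j - v j) ^ 2 ≤ 2 * breg (R i) (gR i) u v)
    (x : ℕ → (i : Fin n) → EuclideanSpace ℝ (Fin (dim i)))
    (hx0 : ∀ i, x 0 i ∈ Kbar i)
    (ghat : ℕ → (i : Fin n) → EuclideanSpace ℝ (Fin (dim i)))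
    (hghat : ∀ τ i j, |ghat τ i j - gΦ (x τ) i j| ≤ εh)
    (eta : Fin n → ℝ) (heta1 : ∀ i, η ≤ eta i) (heta2 : ∀ i, eta i ≤ 1 / lam)
    (hupdate : ∀ τ i, x (τ + 1) i ∈ Kbar i ∧ ∀ z ∈ Kbar i,
      eta i * ⟪ghat τ i, x (τ + 1) i⟫ + breg (R i) (gR i) (x (τ + 1) i) (x τ i)
        ≤ eta i * ⟪ghat τ i, z⟫ + breg (R i) (gR i) z (x τ i))
    (θ δ : ℝ) (hθ : θ = Real.sqrt (η * Γ * εh * n)) (hθ1 : θ ≤ 1)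
    (hδ : δ = 6 * εh + θ * β * d * Λ) :
    ∀ τ : ℕ, α / δ ≤ τ → Φ (x τ) ≤ Φ q + 3 * δ / θ := by
  have hn' : (0:ℝ) < n := by exact_mod_cast hn
  have hP : 0 < η * Γ * εh * n := by positivity
  have hθ0 : 0 < θ := by rw [hθ]; exact Real.sqrt_pos.2 hP
  have hθ2 : θ ^ 2 = η * Γ * εh * n := by rw [hθ]; exact Real.sq_sqrt hP.le
  have hδ0 : 0 < δ := by rw [hδ]; positivity
  have hxb : ∀ τ i, x τ i ∈ Kbar i := by
    intro τ
    cases τ with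
    | zero => exact hx0
    | succ τ => exact fun i => (hupdate τ i).1
  have hxK : ∀ τ i, x τ i ∈ K i := fun τ i => hKbarsub i (hxb τ i)
  obtain ⟨y, hyb, hyq⟩ := happrox q hqK
  have hyK : ∀ i, y i ∈ K i := fun i => hKbarsub i (hyb i)
  have hstep : ∀ τ, Φ (x (τ + 1)) - Φ q ≤ (1 - θ) * (Φ (x τ) - Φ q) + δ := by
    intro τ
    have hs := hsmooth (x τ) (x (τ + 1)) (hxK τ) (hxK (τ + 1))
    have hc := hconv (x τ) q (hxK τ) hqK
    -- blockwise bound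
    have hblock : ∀ i, ⟪gΦ (x τ) i, x (τ + 1) i - x τ i⟫
        + lam / 2 * ∑ j, (x (τ + 1) i j - x τ i j) ^ 2
        ≤ εh * (∑ j, |x (τ + 1) i j - x τ i j|)
          + θ * (εh * (∑ j, |y i j - x τ i j|))
          + θ * (β * (∑ j, |q i j - y i j|))
          + θ * ⟪gΦ (x τ) i, q i - x τ i⟫
          + εh * (∑ j, |y i j - x τ i j|) := by
      intro i
      have he : 0 < eta i := lt_of_lt_of_le hη (heta1 i)
      have hel : eta i * lam ≤ 1 := by
        have := heta2 i
        rwa [le_div_iff₀ hlam] at this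
      set z : EuclideanSpace ℝ (Fin (dim i)) := x τ i + θ • (y i - x τ i) with hz
      have hzb : z ∈ Kbar i := (hKbarconv i).add_smul_sub_mem (hxb τ i) (hyb i) ⟨hθ0.le, hθ1⟩
      have hu := (hupdate τ i).2 z hzb
      have hB1 := (hΓB i _ (hxb (τ + 1) i) _ (hxb τ i)).2
      have hB2 := (hΓB i _ hzb _ (hxb τ i)).1
      set B1 := breg (R i) (gR i) (x (τ + 1) i) (x τ i)
      set B2 := breg (R i) (gR i) z (x τ i)
      have hzsq : ∑ j, (z j - x τ i j) ^ 2 = θ ^ 2 * ∑ j, (y i j - x τ i j) ^ 2 := by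
        rw [Finset.mul_sum]
        refine Finset.sum_congr rfl fun j _ => ?_
        simp [hz]; ring
      have hsq : ∑ j, (y i j - x τ i j) ^ 2 ≤ 1 / n * ∑ j, |y i j - x τ i j| := by
        rw [Finset.mul_sum]
        refine Finset.sum_le_sum fun j _ => ?_
        have h1 := hcoord i _ (hyK i) j
        have h2 := hcoord i _ (hxK τ i) j
        have h3 : |y i j - x τ i j| ≤ 1 / n := by
          rw [abs_le]; constructor <;> linarith [h1.1, h1.2, h2.1, h2.2]
        rw [← sq_abs, sq]
        exact mul_le_mul_of_nonneg_right h3 (abs_nonneg _)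
      set S := ∑ j, |y i j - x τ i j|
      have hS0 : 0 ≤ S := Finset.sum_nonneg fun j _ => abs_nonneg _
      have hB2' : B2 ≤ η * (εh * S) := by
        have h1 : θ ^ 2 * ∑ j, (y i j - x τ i j) ^ 2 ≤ θ ^ 2 * (1 / n * S) :=
          mul_le_mul_of_nonneg_left hsq (sq_nonneg _)
        have h2 : θ ^ 2 * (1 / n * S) = Γ * (η * (εh * S)) := by
          rw [hθ2]; field_simp
        rw [hzsq] at hB2
        exact le_of_mul_le_mul_left (by linarith) hΓ
      have hB2'' : B2 ≤ eta i * (εh * S) :=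
        hB2'.trans (mul_le_mul_of_nonneg_right (heta1 i) (by positivity))
      have hB10 : 0 ≤ B1 := by
        have : 0 ≤ ∑ j, (x (τ + 1) i j - x τ i j) ^ 2 :=
          Finset.sum_nonneg fun j _ => sq_nonneg _
        linarith
      have hz2 : ⟪ghat τ i, z⟫ = ⟪ghat τ i, x τ i⟫ + θ * ⟪ghat τ i, y i - x τ i⟫ := by
        rw [hz, inner_add_right, inner_smul_right]
      -- multiplied descent
      have hd1 : lam / 2 * ∑ j, (x (τ + 1) i j - x τ i j) ^ 2 ≤ lam * B1 := by
        have := mul_le_mul_of_nonneg_left hB1 hlam.le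
        linarith
      have hd2 : eta i * (lam * B1) ≤ B1 := by
        have := mul_le_mul_of_nonneg_right hel hB10
        linarith
      have hd3 : ⟪ghat τ i, x (τ + 1) i - x τ i⟫ + lam * B1
          ≤ θ * ⟪ghat τ i, y i - x τ i⟫ + εh * S := by
        refine le_of_mul_le_mul_left ?_ he
        rw [inner_sub_right (ghat τ i) (x (τ + 1) i)]
        rw [hz2] at hu
        linarith
      have e1 : ⟪gΦ (x τ) i, x (τ + 1) i - x τ i⟫ ≤ ⟪ghat τ i, x (τ + 1) i - x τ i⟫
          + εh * (∑ j, |x (τ + 1) i j - x τ i j|) := by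
        have := amd_inner_le (gΦ (x τ) i - ghat τ i) (x (τ + 1) i - x τ i) εh (fun j => by
          have := hghat τ i j
          rw [abs_sub_comm] at this
          simpa using this)
        rw [inner_sub_left] at this
        simp only [PiLp.sub_apply] at this
        linarith
      have e2 : ⟪ghat τ i, y i - x τ i⟫ ≤ ⟪gΦ (x τ) i, y i - x τ i⟫ + εh * S := by
        have := amd_inner_le (ghat τ i - gΦ (x τ) i) (y i - x τ i) εh (fun j => by
          simpa using hghat τ i j)
        rw [inner_sub_left] at this
        simp only [PiLp.sub_apply] at this
        linarith
      have e3 : ⟪gΦ (x τ) i, y i - x τ i⟫ ≤ β * (∑ j, |q i j - y i j|)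
          + ⟪gΦ (x τ) i, q i - x τ i⟫ := by
        have := amd_inner_le (gΦ (x τ) i) (y i - q i) β (hgradbound _ (hxK τ) i)
        simp only [PiLp.sub_apply, abs_sub_comm (y i _) (q i _)] at this
        have h2 : y i - x τ i = (y i - q i) + (q i - x τ i) := by abel
        rw [h2, inner_add_right]
        linarith
      have e4 := mul_le_mul_of_nonneg_left (e2.trans (add_le_add_left e3 (εh * S))) hθ0.le
      linarith
    have hsum := Finset.sum_le_sum fun i (_ : i ∈ Finset.univ) => hblock i
    simp only [Finset.sum_add_distrib, ← Finset.mul_sum] at hsum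
    have d1 := hdiam _ _ (hxK (τ + 1)) (hxK τ)
    have d2 := hdiam _ _ hyK (hxK τ)
    have f1 := mul_le_mul_of_nonneg_left d1 hεh.le
    have f2 := mul_le_mul_of_nonneg_left d2 hεh.le
    have f3 := mul_le_mul_of_nonneg_left f2 hθ0.le
    have f4 := mul_le_mul_of_nonneg_left (mul_le_mul_of_nonneg_left hyq hβ.le) hθ0.le
    have f5 := mul_le_mul_of_nonneg_left hc hθ0.le
    have f6 : θ * (εh * 2) ≤ 2 * εh := by nlinarith
    rw [hδ]
    linarith
  intro τ hτ
  have h0 : Φ (x 0) - Φ q ≤ α := by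
    have := (hΦrange _ (hxK 0)).2
    have := (hΦrange _ hqK).1
    linarith
  have := amd_rec (fun t => Φ (x t) - Φ q) α θ δ hα hθ0 hθ1 hδ0 h0 hstep τ hτ
  linarith
end

section
/- One-step decrease of generalized mirror descent with approximate gradients: under the same setting — 𝒦 = 𝒦₁ × ⋯ × 𝒦_n ⊆ ℝ^D with each 𝒦_i compact convex, every coordinate of every point of 𝒦 in [0,1/n], ‖x − y‖₁ ≤ 2 for all x, y ∈ 𝒦; Φ : 𝒦 → ℝ convex and differentiable with ‖∇Φ(x)‖_∞ ≤ β and Φ(x') ≤ Φ(x) + ⟨∇Φ(x), x'−x⟩ + (λ/2)‖x'−x‖₂² for all x, x' ∈ 𝒦; q a minimizer of Φ over 𝒦; convex sets 𝒦̄_i ⊆ 𝒦_i such that every x ∈ 𝒦 has some y ∈ 𝒦̄ = 𝒦̄₁ × ⋯ × 𝒦̄_n with ‖x − y‖₁ ≤ dΛ; regularizers R_i with Γ·B^{R_i}(u,v) ≤ ‖u−v‖₂² ≤ 2·B^{R_i}(u,v) on 𝒦̄_i; updates x_i^{τ+1} = argmin_{z∈𝒦̄_i} { η_i ⟨ĝ_i^τ,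 z⟩ + B^{R_i}(z, x_i^τ) } with ‖ĝ_i^τ − ∇_iΦ(x^τ)‖_∞ ≤ ε̂ and η ≤ η_i ≤ 1/λ; θ = √(ηΓε̂n) ≤ 1 and δ = 6ε̂ + θβdΛ — it holds for every integer τ ≥ 0 that Φ(x^{τ+1}) ≤ Φ(x^τ) − θ·(Φ(x^τ) − Φ(q)) + δ. In particular, Φ(x^{τ+1}) ≤ Φ(x^τ) − δ whenever Φ(x^τ) − Φ(q) ≥ 2δ/θ. -/
open Finset RealInnerProductSpace

theorem aux_inner_le {n : ℕ} (dim : Fin n → ℕ)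
    (a b : (i : Fin n) → EuclideanSpace ℝ (Fin (dim i))) (c : ℝ)
    (h : ∀ i j, |a i j| ≤ c) :
    ∑ i, ⟪a i, b i⟫ ≤ c * ∑ i, ∑ j, |b i j| := by
  rw [Finset.mul_sum]
  refine Finset.sum_le_sum fun i _ => ?_
  rw [Finset.mul_sum, PiLp.inner_apply]
  refine Finset.sum_le_sum fun j _ => ?_
  have h1 : ⟪a i j, b i j⟫ = a i j * b i j := by
    simp [mul_comm]
  rw [h1]
  calc a i j * b i j ≤ |a i j * b i j| := le_abs_self _
    _ = |a i j| * |b i j| := abs_mul _ _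
    _ ≤ c * |b i j| := mul_le_mul_of_nonneg_right (h i j) (abs_nonneg _)

/-- one-step decrease of generalized mirror descent with approximate
gradients.  Under the setting of the approximate mirror-descent dynamics (coordinates of
`𝒦` in `[0,1/n]`, ℓ₁-diameter at most `2`, convex `Φ` with `‖∇Φ‖_∞ ≤ β` and Euclidean
`λ`-smoothness, truncated sets `𝒦̄_i` approximating `𝒦` within `dΛ` in ℓ₁, regularizers
with `Γ·B ≤ ‖·‖₂² ≤ 2B`, approximate gradients with coordinatewise error `ε̂`, step
sizes `η ≤ η_i ≤ 1/λ`, `θ = √(ηΓε̂n) ≤ 1`, `δ = 6ε̂ + θβdΛ`), for every `τ ≥ 0`: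
`Φ(x^{τ+1}) ≤ Φ(x^τ) − θ(Φ(x^τ) − Φ(q)) + δ`; in particular
`Φ(x^{τ+1}) ≤ Φ(x^τ) − δ` whenever `Φ(x^τ) − Φ(q) ≥ 2δ/θ`. -/
theorem approx_mirror_descent_one_step
    {n : ℕ} (hn : 0 < n) (dim : Fin n → ℕ)
    (K Kbar : (i : Fin n) → Set (EuclideanSpace ℝ (Fin (dim i))))
    (hKconv : ∀ i, Convex ℝ (K i)) (hKcpt : ∀ i, IsCompact (K i))
    (hKbarsub : ∀ i, Kbar i ⊆ K i) (hKbarconv : ∀ i, Convex ℝ (Kbar i))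
    (hcoord : ∀ i, ∀ u ∈ K i, ∀ j, u j ∈ Set.Icc (0:ℝ) (1 / n))
    (hdiam : ∀ u v : (i : Fin n) → EuclideanSpace ℝ (Fin (dim i)),
      (∀ i, u i ∈ K i) → (∀ i, v i ∈ K i) → ∑ i, ∑ j, |u i j - v i j| ≤ 2)
    (Φ : ((i : Fin n) → EuclideanSpace ℝ (Fin (dim i))) → ℝ)
    (gΦ : ((i : Fin n) → EuclideanSpace ℝ (Fin (dim i))) →
          ((i : Fin n) → EuclideanSpace ℝ (Fin (dim i))))
    (β lam d Λ Γ η εh : ℝ)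
    (hβ : 0 < β) (hlam : 0 < lam) (hd : 0 < d) (hΛ : 0 < Λ)
    (hΓ : 0 < Γ) (hη : 0 < η) (hεh : 0 < εh)
    (hgradbound : ∀ x, (∀ i, x i ∈ K i) → ∀ i j, |gΦ x i j| ≤ β)
    (hconv : ∀ x y, (∀ i, x i ∈ K i) → (∀ i, y i ∈ K i) →
      Φ x + ∑ i, ⟪gΦ x i, y i - x i⟫ ≤ Φ y)
    (hsmooth : ∀ x y, (∀ i, x i ∈ K i) → (∀ i, y i ∈ K i) →
      Φ y ≤ Φ x + ∑ i, ⟪gΦ x i, y i - x i⟫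
            + lam / 2 * ∑ i, ∑ j, (y i j - x i j) ^ 2)
    (q : (i : Fin n) → EuclideanSpace ℝ (Fin (dim i)))
    (hqK : ∀ i, q i ∈ K i) (hqmin : ∀ z, (∀ i, z i ∈ K i) → Φ q ≤ Φ z)
    (happrox : ∀ x : (i : Fin n) → EuclideanSpace ℝ (Fin (dim i)),
      (∀ i, x i ∈ K i) → ∃ y : (i : Fin n) → EuclideanSpace ℝ (Fin (dim i)),
        (∀ i, y i ∈ Kbar i) ∧ ∑ i, ∑ j, |x i j - y i j| ≤ d * Λ)
    (R : (i : Fin n) → EuclideanSpace ℝ (Fin (dim i)) → ℝ)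
    (gR : (i : Fin n) → EuclideanSpace ℝ (Fin (dim i)) → EuclideanSpace ℝ (Fin (dim i)))
    (hRgradAt : ∀ i, ∀ v ∈ Kbar i, HasGradientAt (R i) (gR i v) v)
    (hRstrict : ∀ i, StrictConvexOn ℝ (Kbar i) (R i))
    (hΓB : ∀ i, ∀ u ∈ Kbar i, ∀ v ∈ Kbar i,
      Γ * breg (R i) (gR i) u v ≤ ∑ j, (u j - v j) ^ 2 ∧
      ∑ j, (u j - v j) ^ 2 ≤ 2 * breg (R i) (gR i) u v)
    (x : ℕ → (i : Fin n) → EuclideanSpace ℝ (Fin (dim i)))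
    (hx0 : ∀ i, x 0 i ∈ Kbar i)
    (ghat : ℕ → (i : Fin n) → EuclideanSpace ℝ (Fin (dim i)))
    (hghat : ∀ τ i j, |ghat τ i j - gΦ (x τ) i j| ≤ εh)
    (eta : Fin n → ℝ) (heta1 : ∀ i, η ≤ eta i) (heta2 : ∀ i, eta i ≤ 1 / lam)
    (hupdate : ∀ τ i, x (τ + 1) i ∈ Kbar i ∧ ∀ z ∈ Kbar i,
      eta i * ⟪ghat τ i, x (τ + 1) i⟫ + breg (R i) (gR i) (x (τ + 1) i) (x τ i)
        ≤ eta i * ⟪ghat τ i, z⟫ + breg (R i) (gR i) z (x τ i))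
    (θ δ : ℝ) (hθ : θ = Real.sqrt (η * Γ * εh * n)) (hθ1 : θ ≤ 1)
    (hδ : δ = 6 * εh + θ * β * d * Λ) :
    ∀ τ : ℕ,
      Φ (x (τ + 1)) ≤ Φ (x τ) - θ * (Φ (x τ) - Φ q) + δ ∧
      (2 * δ / θ ≤ Φ (x τ) - Φ q → Φ (x (τ + 1)) ≤ Φ (x τ) - δ) := by
  have hθ0 : 0 < θ := by
    rw [hθ]; have : (0:ℝ) < n := by exact_mod_cast hn
    positivity
  have hn' : (0:ℝ) < n := by exact_mod_cast hn
  have hθsq : θ ^ 2 = η * Γ * εh * n := by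
    rw [hθ]; exact Real.sq_sqrt (by positivity)
  intro τ
  have hxb : ∀ i, x τ i ∈ Kbar i := by
    cases τ with
    | zero => exact hx0
    | succ k => exact fun i => (hupdate k i).1
  have hxK : ∀ i, x τ i ∈ K i := fun i => hKbarsub i (hxb i)
  have hpb : ∀ i, x (τ+1) i ∈ Kbar i := fun i => (hupdate τ i).1
  have hpK : ∀ i, x (τ+1) i ∈ K i := fun i => hKbarsub i (hpb i)
  obtain ⟨y, hyb, hyd⟩ := happrox q hqK
  have hyK : ∀ i, y i ∈ K i := fun i => hKbarsub i (hyb i)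
  have hzb : ∀ i, x τ i + θ • (y i - x τ i) ∈ Kbar i := fun i =>
    (hKbarconv i).add_smul_sub_mem (hxb i) (hyb i) ⟨hθ0.le, hθ1⟩
  have hmain : Φ (x (τ + 1)) ≤ Φ (x τ) - θ * (Φ (x τ) - Φ q) + δ := by
    have h1 := hsmooth (x τ) (x (τ+1)) hxK hpK
    have e1 := aux_inner_le dim (fun i => gΦ (x τ) i - ghat τ i)
      (fun i => x (τ+1) i - x τ i) εh (by
        intro i j; have := hghat τ i j; rw [abs_sub_comm] at this; simpa using this)
    have e2 := aux_inner_le dim (fun i => ghat τ i - gΦ (x τ) i)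
      (fun i => y i - x τ i) εh (by
        intro i j; simpa using hghat τ i j)
    have e3 := aux_inner_le dim (fun i => gΦ (x τ) i)
      (fun i => y i - q i) β (fun i j => hgradbound (x τ) hxK i j)
    have d1 := hdiam (x (τ+1)) (x τ) hpK hxK
    have d2 := hdiam y (x τ) hyK hxK
    have d3 : ∑ i, ∑ j, |y i j - q i j| ≤ d * Λ := by
      simpa only [abs_sub_comm] using hyd
    simp only [PiLp.sub_apply] at e1 e2 e3
    have e1' := e1.trans (mul_le_mul_of_nonneg_left d1 hεh.le)
    have e2' := e2.trans (mul_le_mul_of_nonneg_left d2 hεh.le)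
    have e3' := e3.trans (mul_le_mul_of_nonneg_left d3 hβ.le)
    have c1 := hconv (x τ) q hxK hqK
    have sqb : ∑ i, ∑ j, (y i j - x τ i j) ^ 2 ≤ 1 / n * 2 := by
      refine le_trans ?_ (mul_le_mul_of_nonneg_left d2 (by positivity))
      rw [Finset.mul_sum]
      refine Finset.sum_le_sum fun i _ => ?_
      rw [Finset.mul_sum]
      refine Finset.sum_le_sum fun j _ => ?_
      rw [← sq_abs, sq]
      refine mul_le_mul_of_nonneg_right ?_ (abs_nonneg _)
      have a1 := hcoord i _ (hyK i) j
      have a2 := hcoord i _ (hxK i) j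
      rw [abs_le]; constructor <;> linarith [a1.1, a1.2, a2.1, a2.2]
    have step : ∀ i, ⟪ghat τ i, x (τ+1) i - x τ i⟫
        + lam / 2 * ∑ j, (x (τ+1) i j - x τ i j) ^ 2
        ≤ θ * ⟪ghat τ i, y i - x τ i⟫
          + θ ^ 2 / (η * Γ) * ∑ j, (y i j - x τ i j) ^ 2 := by
      intro i
      have he : 0 < eta i := hη.trans_le (heta1 i)
      have u := (hupdate τ i).2 _ (hzb i)
      have b1 := (hΓB i _ (hpb i) _ (hxb i)).2
      have b2 := (hΓB i _ (hzb i) _ (hxb i)).1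
      have sz : ∑ j, ((x τ i + θ • (y i - x τ i)) j - x τ i j) ^ 2
          = θ ^ 2 * ∑ j, (y i j - x τ i j) ^ 2 := by
        rw [Finset.mul_sum]
        refine Finset.sum_congr rfl fun j _ => ?_
        simp only [PiLp.add_apply, PiLp.smul_apply, PiLp.sub_apply, smul_eq_mul]
        ring
      rw [sz] at b2
      rw [inner_add_right, inner_smul_right] at u
      rw [inner_sub_right (ghat τ i) (x (τ+1) i)]
      set B1 := breg (R i) (gR i) (x (τ+1) i) (x τ i)
      set B2 := breg (R i) (gR i) (x τ i + θ • (y i - x τ i)) (x τ i)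
      set S1 := ∑ j, (x (τ+1) i j - x τ i j) ^ 2
      set S2 := ∑ j, (y i j - x τ i j) ^ 2
      have hS1 : 0 ≤ S1 := Finset.sum_nonneg fun j _ => sq_nonneg _
      have hS2 : 0 ≤ S2 := Finset.sum_nonneg fun j _ => sq_nonneg _
      set p := ⟪ghat τ i, x (τ+1) i⟫
      set r := ⟪ghat τ i, x τ i⟫
      set w := ⟪ghat τ i, y i - x τ i⟫
      have hel : eta i * lam ≤ 1 := by
        have := heta2 i; rwa [le_div_iff₀ hlam] at this
      have f1 : eta i * (lam / 2 * S1) ≤ B1 := by nlinarith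
      have f2 : B2 ≤ eta i * (θ ^ 2 / (η * Γ) * S2) := by
        have : B2 ≤ η * (θ ^ 2 / (η * Γ) * S2) := by
          have : η * (θ ^ 2 / (η * Γ) * S2) = θ ^ 2 * S2 / Γ := by field_simp
          rw [this, le_div_iff₀ hΓ]; linarith
        exact this.trans (mul_le_mul_of_nonneg_right (heta1 i) (by positivity))
      refine le_of_mul_le_mul_left ?_ he
      linarith
    have ssum := Finset.sum_le_sum (s := Finset.univ) fun i _ => step i
    simp only [Finset.sum_add_distrib, ← Finset.mul_sum] at ssum
    have l1 : ∑ i, ⟪gΦ (x τ) i - ghat τ i, x (τ+1) i - x τ i⟫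
      = ∑ i, ⟪gΦ (x τ) i, x (τ+1) i - x τ i⟫ - ∑ i, ⟪ghat τ i, x (τ+1) i - x τ i⟫ := by
      simp only [inner_sub_left, Finset.sum_sub_distrib]
    have l2 : ∑ i, ⟪ghat τ i - gΦ (x τ) i, y i - x τ i⟫
      = ∑ i, ⟪ghat τ i, y i - x τ i⟫ - ∑ i, ⟪gΦ (x τ) i, y i - x τ i⟫ := by
      simp only [inner_sub_left, Finset.sum_sub_distrib]
    have l3 : ∑ i, ⟪gΦ (x τ) i, y i - x τ i⟫
      = ∑ i, ⟪gΦ (x τ) i, y i - q i⟫ + ∑ i, ⟪gΦ (x τ) i, q i - x τ i⟫ := by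
      simp only [inner_sub_right, Finset.sum_sub_distrib]; ring
    have t1 : θ ^ 2 / (η * Γ) * ∑ i, ∑ j, (y i j - x τ i j) ^ 2 ≤ 2 * εh := by
      refine (mul_le_mul_of_nonneg_left sqb (by positivity)).trans (le_of_eq ?_)
      rw [hθsq]; field_simp
    have t2 : θ * ∑ i, ⟪ghat τ i, y i - x τ i⟫
        ≤ θ * (2 * εh + β * (d * Λ) + (Φ q - Φ (x τ))) :=
      mul_le_mul_of_nonneg_left (by linarith) hθ0.le
    have t3 : θ * εh ≤ 1 * εh := mul_le_mul_of_nonneg_right hθ1 hεh.le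
    rw [hδ]
    linarith
  refine ⟨hmain, fun h => ?_⟩
  rw [div_le_iff₀ hθ0] at h
  linarith
end
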